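/- arXiv:2406.11692 — 2 statements merged into one kernel-verified Lean document; each statement's English description precedes it below -/
import Mathlib

section
/- (Algebraic DDVV inequality.) For every symmetric bilinear map β ∈ Sym(V×V,W) and every c ∈ ℝ, one has ρ_c(β) ≤ c + H_β² − ρ⊥(β). -/
open scoped RealInnerProductSpace BigOperators
open MeasureTheory Classical

namespace Paper

variable {V W : Type*} [NormedAddCommGroup V] [InnerProductSpace ℝ V]
  [NormedAddCommGroup W] [InnerProductSpace ℝ W]

/-- `β` is a symmetric bilinear map. -/
def IsSymmBil (β : V →ₗ[ℝ] V →ₗ[ℝ] W) : Prop := ∀ x y, β x y = β y x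

/-- The formal shape operator `A_ξ(β)`, determined by `⟪β x y, ξ⟫ = ⟪A_ξ(β) x, y⟫`. -/
noncomputable def shapeOp (β : V →ₗ[ℝ] V →ₗ[ℝ] W) (ξ : W) : V →ₗ[ℝ] V :=
  if h : ∃ A : V →ₗ[ℝ] V, ∀ x y : V, ⟪β x y, ξ⟫ = ⟪A x, y⟫ then h.choose else 0

variable {n m : ℕ}

/-- The mean curvature vector `𝓗_β = (1/n) Σ_i β(e_i, e_i)`. -/
noncomputable def meanCurv (e : OrthonormalBasis (Fin n) ℝ V)
    (β : V →ₗ[ℝ] V →ₗ[ℝ] W) : W :=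
  (n : ℝ)⁻¹ • ∑ i, β (e i) (e i)

/-- The formal Ricci tensor `Ric_c(β)`. -/
noncomputable def ric (c : ℝ) (e : OrthonormalBasis (Fin n) ℝ V)
    (β : V →ₗ[ℝ] V →ₗ[ℝ] W) (x y : V) : ℝ :=
  c * (n - 1) * ⟪x, y⟫ + n * ⟪meanCurv e β, β x y⟫
    - ∑ i, ⟪β x (e i), β y (e i)⟫

/-- The normalized scalar curvature `ρ_c(β) = (1/(n(n-1))) tr Ric_c(β)`. -/
noncomputable def rho (c : ℝ) (e : OrthonormalBasis (Fin n) ℝ V)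
    (β : V →ₗ[ℝ] V →ₗ[ℝ] W) : ℝ :=
  (n * (n - 1) : ℝ)⁻¹ * ∑ i, ric c e β (e i) (e i)

/-- The self-adjoint operator `T_c(β)` with `⟪T_c(β) x, y⟫ = (1/(n-1)) Ric_c(β)(x,y)`. -/
noncomputable def ricOp (c : ℝ) (e : OrthonormalBasis (Fin n) ℝ V)
    (β : V →ₗ[ℝ] V →ₗ[ℝ] W) : V →ₗ[ℝ] V :=
  if h : ∃ T : V →ₗ[ℝ] V, ∀ x y : V, ⟪T x, y⟫ = (n - 1 : ℝ)⁻¹ * ric c e β x y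
  then h.choose else 0

/-- The increasingly ordered eigenvalues of an endomorphism admitting an orthonormal
eigenbasis (junk value otherwise). -/
noncomputable def sortedEigs (n : ℕ) (T : V →ₗ[ℝ] V) : Fin n → ℝ :=
  if h : ∃ μ : Fin n → ℝ, Monotone μ ∧
      ∃ b : OrthonormalBasis (Fin n) ℝ V, ∀ i, T (b i) = μ i • b i
  then h.choose else fun _ => 0

/-- The `k`-th scalar curvature `ρ_{c,k}(β) = (1/k) Σ_{i=1}^k λ_{c,i}(β)`. -/
noncomputable def rhoK (c : ℝ) (k : ℕ) (e : OrthonormalBasis (Fin n) ℝ V)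
    (β : V →ₗ[ℝ] V →ₗ[ℝ] W) : ℝ :=
  (k : ℝ)⁻¹ * ∑ i ∈ Finset.univ.filter (fun i : Fin n => (i : ℕ) < k),
    sortedEigs n (ricOp c e β) i

/-- The normal scalar curvature `ρ⊥(β)`. -/
noncomputable def rhoPerp (e : OrthonormalBasis (Fin n) ℝ V)
    (ξ : OrthonormalBasis (Fin m) ℝ W) (β : V →ₗ[ℝ] V →ₗ[ℝ] W) : ℝ :=
  (n * (n - 1) : ℝ)⁻¹ * Real.sqrt (∑ a, ∑ b, ∑ i,
    ‖(shapeOp β (ξ a) ∘ₗ shapeOp β (ξ b) - shapeOp β (ξ b) ∘ₗ shapeOp β (ξ a)) (e i)‖ ^ 2)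

/-- The index of a self-adjoint endomorphism: the number of negative eigenvalues,
counted with multiplicity. -/
noncomputable def negIndex (n : ℕ) (T : V →ₗ[ℝ] V) : ℕ :=
  (Finset.univ.filter (fun i : Fin n => sortedEigs n T i < 0)).card

/-- The Hilbert–Schmidt norm `‖β‖² = Σ_{i,j} ‖β(e_i,e_j)‖²`. -/
noncomputable def normHS (e : OrthonormalBasis (Fin n) ℝ V)
    (β : V →ₗ[ℝ] V →ₗ[ℝ] W) : ℝ :=
  Real.sqrt (∑ i, ∑ j, ‖β (e i) (e j)‖ ^ 2)

/-- `ψ_p(β) = ∫_{Λ_p(β)} |det A_u(β)| dS_u` over the unit sphere of `W = ℝ^m`. -/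
noncomputable def psi (n m p : ℕ)
    (β : EuclideanSpace ℝ (Fin n) →ₗ[ℝ] EuclideanSpace ℝ (Fin n) →ₗ[ℝ]
      EuclideanSpace ℝ (Fin m)) : ℝ :=
  ∫ u in {u : Metric.sphere (0 : EuclideanSpace ℝ (Fin m)) 1 |
      p < negIndex n (shapeOp β (u : EuclideanSpace ℝ (Fin m))) ∧
      negIndex n (shapeOp β (u : EuclideanSpace ℝ (Fin m))) < n - p},
    |LinearMap.det (shapeOp β (u : EuclideanSpace ℝ (Fin m)))|
    ∂((volume : Measure (EuclideanSpace ℝ (Fin m))).toSphere)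

/-- The squared Hilbert–Schmidt norm of a real matrix. -/
def frobSq {ι κ : Type*} [Fintype ι] [Fintype κ] (A : Matrix ι κ ℝ) : ℝ :=
  ∑ i, ∑ j, A i j ^ 2

lemma frobSq_nonneg {ι κ : Type*} [Fintype ι] [Fintype κ] (A : Matrix ι κ ℝ) : 0 ≤ frobSq A := by
  unfold frobSq; positivity

lemma frobSq_eq_trace {ι κ : Type*} [Fintype ι] [Fintype κ] (A : Matrix ι κ ℝ) :
    frobSq A = (A * A.transpose).trace := by
  simp [frobSq, Matrix.trace, Matrix.mul_apply, sq]

lemma frobSq_zero {ι κ : Type*} [Fintype ι] [Fintype κ] : frobSq (0 : Matrix ι κ ℝ) = 0 := by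
  simp [frobSq]

lemma frobSq_smul {ι κ : Type*} [Fintype ι] [Fintype κ] (r : ℝ) (A : Matrix ι κ ℝ) :
    frobSq (r • A) = r ^ 2 * frobSq A := by
  simp [frobSq, mul_pow, Finset.mul_sum]

lemma frobSq_conj {ι : Type*} [Fintype ι] [DecidableEq ι] (U A : Matrix ι ι ℝ)
    (hU : U * U.transpose = 1) : frobSq (U.transpose * A * U) = frobSq A := by
  have h : U.transpose * A * U * (U.transpose * A * U).transpose
      = U.transpose * (A * A.transpose * U) := by
    simp only [Matrix.transpose_mul, Matrix.transpose_transpose, Matrix.mul_assoc]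
    rw [← Matrix.mul_assoc U U.transpose, hU, Matrix.one_mul]
  rw [frobSq_eq_trace, frobSq_eq_trace, h, Matrix.trace_mul_comm, Matrix.mul_assoc, hU,
    Matrix.mul_one]

lemma transpose_mul_mul_apply {κ : Type*} [Fintype κ] (P G : Matrix κ κ ℝ) (a b : κ) :
    (P.transpose * G * P) a b = ∑ q, ∑ p, P p a * G p q * P q b := by
  simp [Matrix.mul_apply, Finset.sum_mul]

lemma exists_orthogonal_diagonalization {ι : Type*} [Fintype ι] [DecidableEq ι]
    (A : Matrix ι ι ℝ) (hA : A.IsSymm) :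
    ∃ (U : Matrix ι ι ℝ) (d : ι → ℝ), U * U.transpose = 1 ∧ U.transpose * U = 1 ∧
      U.transpose * A * U = Matrix.diagonal d := by
  have hH : A.IsHermitian := by
    rw [Matrix.IsHermitian, Matrix.conjTranspose_eq_transpose_of_trivial]; exact hA
  have h1 : (hH.eigenvectorUnitary : Matrix ι ι ℝ) *
      (hH.eigenvectorUnitary : Matrix ι ι ℝ).transpose = 1 := by
    have := Matrix.mem_unitaryGroup_iff.mp hH.eigenvectorUnitary.2
    rwa [Matrix.star_eq_conjTranspose, Matrix.conjTranspose_eq_transpose_of_trivial] at this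
  have h2 := mul_eq_one_comm.mp h1
  refine ⟨hH.eigenvectorUnitary, hH.eigenvalues, h1, h2, ?_⟩
  have h := hH.spectral_theorem
  rw [Unitary.conjStarAlgAut_apply, Matrix.star_eq_conjTranspose,
    Matrix.conjTranspose_eq_transpose_of_trivial] at h
  refine (congrArg (fun M => (hH.eigenvectorUnitary : Matrix ι ι ℝ).transpose * M *
    (hH.eigenvectorUnitary : Matrix ι ι ℝ)) h).trans ?_
  simp only [Matrix.mul_assoc, h2, Matrix.mul_one]
  rw [← Matrix.mul_assoc, h2, Matrix.one_mul]
  rfl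

/-- Any two pairs of coordinates at distance more than one meet, and no three coordinates are
pairwise at distance more than one, so all such pairs share a common index. -/
lemma exists_common_index {ι : Type*} [Fintype ι] [DecidableEq ι] (d : ι → ℝ)
    (hd : ∑ i, d i ^ 2 ≤ 1) {i j : ι} (hij : 1 < (d i - d j) ^ 2) :
    ∃ p, ∀ k l, 1 < (d k - d l) ^ 2 → k = p ∨ l = p := by
  have hsum : ∀ s : Finset ι, ∑ i ∈ s, d i ^ 2 ≤ 1 := fun s =>
    (Finset.sum_le_sum_of_subset_of_nonneg (Finset.subset_univ s)
      fun _ _ _ => sq_nonneg _).trans hd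
  have hne : ∀ k l, 1 < (d k - d l) ^ 2 → k ≠ l := by
    rintro k l h rfl
    norm_num at h
  have hpair : ∀ k l, k ≠ l → d k ^ 2 + d l ^ 2 ≤ 1 := fun k l h => by
    simpa [Finset.sum_pair h] using hsum {k, l}
  have hmeet : ∀ a b k l, 1 < (d a - d b) ^ 2 → 1 < (d k - d l) ^ 2 →
      k = a ∨ k = b ∨ l = a ∨ l = b := by
    intro a b k l h1 h2
    by_contra! hc
    obtain ⟨n1, n2, n3, n4⟩ := hc
    have := hsum {a, b, k, l}
    rw [Finset.sum_insert (by simp [hne _ _ h1, n1.symm, n3.symm]),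
      Finset.sum_insert (by simp [n2.symm, n4.symm]), Finset.sum_pair (hne _ _ h2)] at this
    nlinarith [sq_nonneg (d a + d b), sq_nonneg (d k + d l)]
  have hopp : ∀ k l, 1 < (d k - d l) ^ 2 → d k * d l < 0 := by
    intro k l h
    nlinarith [hpair k l (hne k l h)]
  have htri : ∀ a b k, 1 < (d a - d b) ^ 2 → 1 < (d b - d k) ^ 2 → 1 < (d a - d k) ^ 2 →
      False := by
    intro a b k h1 h2 h3
    have h12 := mul_pos_of_neg_of_neg (hopp a b h1) (hopp b k h2)
    nlinarith [mul_nonneg (sq_nonneg (d b)) (neg_nonneg.mpr (hopp a k h3).le)]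
  have hsymm : ∀ k l, 1 < (d k - d l) ^ 2 → 1 < (d l - d k) ^ 2 := fun k l h => by
    nlinarith
  by_contra! hc
  obtain ⟨a, b, hab, ha, hb⟩ := hc i
  obtain ⟨k, l, hkl, hk, hl⟩ := hc j
  have m1 := hmeet i j a b hij hab
  have m2 := hmeet i j k l hij hkl
  have m3 := hmeet a b k l hab hkl
  grind

lemma sum_sq_dist_excess_star {ι : Type*} [Fintype ι] [DecidableEq ι] (d : ι → ℝ)
    (hd : ∑ i, d i ^ 2 ≤ 1) (p : ι) (s : Finset ι) (hp : p ∉ s) :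
    ∑ j ∈ s, ((d p - d j) ^ 2 - 1) ≤ 1 := by
  have h1 : d p ^ 2 + ∑ j ∈ s, d j ^ 2 ≤ 1 := by
    rw [← Finset.sum_insert (f := fun j => d j ^ 2) hp]
    exact (Finset.sum_le_sum_of_subset_of_nonneg (Finset.subset_univ _)
      fun _ _ _ => sq_nonneg _).trans hd
  have h2 : (∑ j ∈ s, d j) ^ 2 ≤ s.card * ∑ j ∈ s, d j ^ 2 := sq_sum_le_card_mul_sum_sq
  have h3 : ∑ j ∈ s, ((d p - d j) ^ 2 - 1)
      = s.card * d p ^ 2 - 2 * d p * ∑ j ∈ s, d j + ∑ j ∈ s, d j ^ 2 - s.card := by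
    simp only [sub_sq, Finset.sum_sub_distrib, Finset.sum_add_distrib, Finset.sum_const,
      nsmul_eq_mul, Finset.mul_sum, mul_one]
  rw [h3]
  have hs : (0 : ℝ) ≤ s.card := by positivity
  nlinarith [sq_nonneg (d p + ∑ j ∈ s, d j), mul_nonneg hs (sub_nonneg.mpr h1)]

lemma sum_sq_dist_excess_le {ι : Type*} [Fintype ι] [DecidableEq ι] (d : ι → ℝ)
    (hd : ∑ i, d i ^ 2 ≤ 1) :
    ∑ i, ∑ j, max ((d i - d j) ^ 2 - 1) 0 ≤ 2 := by
  by_cases h : ∃ i j, 1 < (d i - d j) ^ 2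
  · obtain ⟨i, j, hij⟩ := h
    obtain ⟨p, hp⟩ := exists_common_index d hd hij
    have hstar : ∑ j, max ((d p - d j) ^ 2 - 1) 0 ≤ 1 := by
      have : ∑ j, max ((d p - d j) ^ 2 - 1) 0
          = ∑ j with 1 < (d p - d j) ^ 2, ((d p - d j) ^ 2 - 1) := by
        rw [Finset.sum_filter]
        refine Finset.sum_congr rfl fun j _ => ?_
        split_ifs with h
        · exact max_eq_left (by linarith)
        · exact max_eq_right (by linarith)
      rw [this]
      exact sum_sq_dist_excess_star d hd p _ (by simp)
    have hle : ∀ i j, max ((d i - d j) ^ 2 - 1) 0 ≤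
        (if i = p then max ((d p - d j) ^ 2 - 1) 0 else 0) +
        (if j = p then max ((d p - d i) ^ 2 - 1) 0 else 0) := by
      intro i j
      by_cases hij : 1 < (d i - d j) ^ 2
      · rcases hp i j hij with rfl | rfl
        · simp only [if_true]
          have : (0 : ℝ) ≤ if j = i then max ((d i - d i) ^ 2 - 1) 0 else 0 := by
            split_ifs <;> simp
          linarith
        · simp only [if_true]
          have : (0 : ℝ) ≤ if i = j then max ((d j - d j) ^ 2 - 1) 0 else 0 := by
            split_ifs <;> simp
          rw [show (d j - d i) ^ 2 = (d i - d j) ^ 2 by ring]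
          linarith
      · rw [max_eq_right (by linarith)]
        refine add_nonneg ?_ ?_ <;> split_ifs <;> simp
    calc _ ≤ ∑ i, ∑ j, ((if i = p then max ((d p - d j) ^ 2 - 1) 0 else 0) +
        (if j = p then max ((d p - d i) ^ 2 - 1) 0 else 0)) :=
          Finset.sum_le_sum fun i _ => Finset.sum_le_sum fun j _ => hle i j
      _ = 2 * ∑ j, max ((d p - d j) ^ 2 - 1) 0 := by
          simp only [Finset.sum_add_distrib]
          rw [Finset.sum_comm]
          simp [two_mul]
      _ ≤ 2 := by linarith
  · push Not at h
    have : ∀ i j, max ((d i - d j) ^ 2 - 1) 0 = 0 := fun i j =>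
      max_eq_right (by linarith [h i j])
    simp [this]

/-- Bessel's inequality for pairwise orthogonal vectors of norm at most one. -/
lemma sum_sq_inner_le_of_orthogonal {F ι : Type*} [NormedAddCommGroup F] [InnerProductSpace ℝ F]
    [Fintype ι] (v : ι → F) (hv : ∀ a b, a ≠ b → ⟪v a, v b⟫ = 0) (hv1 : ∀ a, ‖v a‖ ^ 2 ≤ 1)
    (x : F) : ∑ a, ⟪v a, x⟫ ^ 2 ≤ ‖x‖ ^ 2 := by
  have h1 : ⟪x, ∑ a, ⟪v a, x⟫ • v a⟫ = ∑ a, ⟪v a, x⟫ ^ 2 := by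
    simp only [inner_sum, inner_smul_right, real_inner_comm x, sq]
  have h2 : ‖∑ a, ⟪v a, x⟫ • v a‖ ^ 2 ≤ ∑ a, ⟪v a, x⟫ ^ 2 := by
    rw [← real_inner_self_eq_norm_sq, sum_inner]
    refine Finset.sum_le_sum fun a _ => ?_
    rw [inner_sum, Finset.sum_eq_single a]
    · rw [real_inner_smul_left, real_inner_smul_right, real_inner_self_eq_norm_sq]
      nlinarith [hv1 a, sq_nonneg ⟪v a, x⟫]
    · intro b _ hb
      rw [real_inner_smul_left, real_inner_smul_right, hv a b hb.symm]; simp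
    · simp
  have h3 := norm_sub_sq_real x (∑ a, ⟪v a, x⟫ • v a)
  rw [h1] at h3
  nlinarith [sq_nonneg ‖x - ∑ a, ⟪v a, x⟫ • v a‖]

lemma sum_entry_sq_le_half {ι κ : Type*} [Fintype ι] [DecidableEq ι] [Fintype κ]
    (B : κ → Matrix ι ι ℝ) (hB : ∀ a, (B a).IsSymm)
    (horth : ∀ a b, a ≠ b → (B a * (B b).transpose).trace = 0)
    (hnorm : ∀ a, frobSq (B a) ≤ 1) {i j : ι} (hij : i ≠ j) :
    ∑ a, B a i j ^ 2 ≤ 1 / 2 := by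
  let v : κ → EuclideanSpace ℝ (ι × ι) := fun a => WithLp.toLp 2 fun k => B a k.1 k.2
  have h := sum_sq_inner_le_of_orthogonal v
    (fun a b hab => by
      rw [← horth b a hab.symm]
      simp [v, PiLp.inner_apply, Fintype.sum_prod_type, Matrix.trace, Matrix.mul_apply])
    (fun a => by
      simpa [v, EuclideanSpace.norm_sq_eq, Fintype.sum_prod_type, frobSq] using hnorm a)
    (EuclideanSpace.single (i, j) 1 + EuclideanSpace.single (j, i) 1)
  have hv : ∀ a, ⟪v a, EuclideanSpace.single (i, j) 1 + EuclideanSpace.single (j, i) 1⟫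
      = 2 * B a i j := by
    intro a
    rw [inner_add_right, EuclideanSpace.inner_single_right, EuclideanSpace.inner_single_right]
    simp [v, (hB a).apply i j, two_mul]
  have hx : ‖(EuclideanSpace.single (i, j) 1 + EuclideanSpace.single (j, i) 1 :
      EuclideanSpace ℝ (ι × ι))‖ ^ 2 = 2 := by
    rw [norm_add_sq_real, EuclideanSpace.inner_single_right]
    simp [hij, hij.symm]
    norm_num
  simp only [hv, hx, mul_pow, ← Finset.mul_sum] at h
  linarith

lemma frobSq_commutator_diagonal {ι : Type*} [Fintype ι] [DecidableEq ι] (d : ι → ℝ)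
    (B : Matrix ι ι ℝ) :
    frobSq (Matrix.diagonal d * B - B * Matrix.diagonal d)
      = ∑ i, ∑ j, (d i - d j) ^ 2 * B i j ^ 2 := by
  refine Finset.sum_congr rfl fun i _ => Finset.sum_congr rfl fun j _ => ?_
  rw [Matrix.sub_apply, Matrix.diagonal_mul, Matrix.mul_diagonal]
  ring

lemma sum_frobSq_commutator_diagonal_le {ι κ : Type*} [Fintype ι] [DecidableEq ι] [Fintype κ]
    (d : ι → ℝ) (hd : ∑ i, d i ^ 2 ≤ 1) (B : κ → Matrix ι ι ℝ) (hB : ∀ a, (B a).IsSymm)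
    (horth : ∀ a b, a ≠ b → (B a * (B b).transpose).trace = 0)
    (hnorm : ∀ a, frobSq (B a) ≤ 1) (y : κ → ℝ) (Y : ℝ) (hy : ∀ a, 0 ≤ y a) (hY : ∀ a, y a ≤ Y)
    (hY0 : 0 ≤ Y) :
    ∑ a, y a * frobSq (Matrix.diagonal d * B a - B a * Matrix.diagonal d)
      ≤ ∑ a, y a * frobSq (B a) + Y := by
  have hentry : ∀ i j, ∑ a, y a * (((d i - d j) ^ 2 - 1) * B a i j ^ 2)
      ≤ max ((d i - d j) ^ 2 - 1) 0 * (Y / 2) := by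
    intro i j
    by_cases hij : i = j
    · subst hij
      simp only [sub_self]
      norm_num
      exact Finset.sum_nonneg fun a _ => mul_nonneg (hy a) (sq_nonneg _)
    calc _ ≤ ∑ a, max ((d i - d j) ^ 2 - 1) 0 * (Y * B a i j ^ 2) := by
          refine Finset.sum_le_sum fun a _ => ?_
          calc y a * (((d i - d j) ^ 2 - 1) * B a i j ^ 2)
              ≤ y a * (max ((d i - d j) ^ 2 - 1) 0 * B a i j ^ 2) := by
                gcongr
                · exact hy a
                · exact le_max_left _ _
            _ ≤ Y * (max ((d i - d j) ^ 2 - 1) 0 * B a i j ^ 2) := by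
                gcongr
                exact hY a
            _ = _ := by ring
      _ = max ((d i - d j) ^ 2 - 1) 0 * (Y * ∑ a, B a i j ^ 2) := by
          simp only [Finset.mul_sum]
      _ ≤ _ := by
          gcongr
          have := sum_entry_sq_le_half B hB horth hnorm hij
          nlinarith
  have hdiff : ∑ a, y a * frobSq (Matrix.diagonal d * B a - B a * Matrix.diagonal d)
      - ∑ a, y a * frobSq (B a)
      = ∑ i, ∑ j, ∑ a, y a * (((d i - d j) ^ 2 - 1) * B a i j ^ 2) := by
    rw [← Finset.sum_sub_distrib]
    have : ∀ a, y a * frobSq (Matrix.diagonal d * B a - B a * Matrix.diagonal d)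
        - y a * frobSq (B a) = ∑ i, ∑ j, y a * (((d i - d j) ^ 2 - 1) * B a i j ^ 2) := by
      intro a
      rw [frobSq_commutator_diagonal, frobSq, ← mul_sub, ← Finset.sum_sub_distrib, Finset.mul_sum]
      refine Finset.sum_congr rfl fun i _ => ?_
      rw [← Finset.sum_sub_distrib, Finset.mul_sum]
      exact Finset.sum_congr rfl fun j _ => by ring
    simp only [this]
    rw [Finset.sum_comm]
    exact Finset.sum_congr rfl fun i _ => Finset.sum_comm
  have hbound : ∑ i, ∑ j, ∑ a, y a * (((d i - d j) ^ 2 - 1) * B a i j ^ 2) ≤ Y := by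
    calc _ ≤ ∑ i, ∑ j, max ((d i - d j) ^ 2 - 1) 0 * (Y / 2) :=
          Finset.sum_le_sum fun i _ => Finset.sum_le_sum fun j _ => hentry i j
      _ = (∑ i, ∑ j, max ((d i - d j) ^ 2 - 1) 0) * (Y / 2) := by
          simp only [Finset.sum_mul]
      _ ≤ 2 * (Y / 2) := by
          gcongr
          exact sum_sq_dist_excess_le d hd
      _ = Y := by ring
  linarith

lemma sum_frobSq_commutator_le {ι κ : Type*} [Fintype ι] [DecidableEq ι] [Fintype κ]
    (A : Matrix ι ι ℝ) (hA : A.IsSymm) (hA1 : frobSq A ≤ 1) (B : κ → Matrix ι ι ℝ)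
    (hB : ∀ a, (B a).IsSymm) (horth : ∀ a b, a ≠ b → (B a * (B b).transpose).trace = 0)
    (hnorm : ∀ a, frobSq (B a) ≤ 1) (y : κ → ℝ) (Y : ℝ) (hy : ∀ a, 0 ≤ y a) (hY : ∀ a, y a ≤ Y)
    (hY0 : 0 ≤ Y) :
    ∑ a, y a * frobSq (A * B a - B a * A) ≤ ∑ a, y a * frobSq (B a) + Y := by
  obtain ⟨U, d, hU, -, hUA⟩ := exists_orthogonal_diagonalization A hA
  have hmul : ∀ M N : Matrix ι ι ℝ, U.transpose * (M * N) * U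
      = (U.transpose * M * U) * (U.transpose * N * U) := by
    intro M N
    simp only [Matrix.mul_assoc]
    rw [← Matrix.mul_assoc U U.transpose, hU, Matrix.one_mul]
  have hd : ∑ i, d i ^ 2 ≤ 1 := by
    rw [← frobSq_conj U A hU, hUA] at hA1
    refine le_trans (le_of_eq ?_) hA1
    refine Finset.sum_congr rfl fun i _ => ?_
    rw [Finset.sum_eq_single i] <;> simp +contextual [eq_comm]
  have h := sum_frobSq_commutator_diagonal_le d hd (fun a => U.transpose * B a * U)
    (fun a => by
      rw [Matrix.IsSymm, Matrix.transpose_mul, Matrix.transpose_mul, Matrix.transpose_transpose,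
        (hB a).eq, Matrix.mul_assoc])
    (fun a b hab => by
      have : (U.transpose * B b * U).transpose = U.transpose * (B b).transpose * U := by
        simp [Matrix.mul_assoc]
      rw [this, ← hmul, Matrix.mul_assoc, Matrix.trace_mul_comm, Matrix.mul_assoc, hU,
        Matrix.mul_one, horth a b hab])
    (fun a => by rw [frobSq_conj U _ hU]; exact hnorm a) y Y hy hY hY0
  simp only [← hUA, ← hmul, ← sub_mul, ← mul_sub, frobSq_conj U _ hU] at h
  exact h

/-- A quadratic form on the simplex is at most one if its partial derivative along a largest
coordinate is suitably bounded. -/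
lemma quadratic_le_one_on_stdSimplex {κ : Type*} [Fintype κ] [Nonempty κ] (c : κ → κ → ℝ)
    (hsymm : ∀ a b, c a b = c b a)
    (hc : ∀ x ∈ stdSimplex ℝ κ, ∀ a, (∀ b, x b ≤ x a) → ∑ b, c a b * x b ≤ 1)
    (x : κ → ℝ) (hx : x ∈ stdSimplex ℝ κ) : ∑ a, ∑ b, c a b * x a * x b ≤ 1 := by
  classical
  have hcont : Continuous fun x : κ → ℝ => ∑ a, ∑ b, c a b * x a * x b := by fun_prop
  obtain ⟨z, hz, hmax⟩ := (isCompact_stdSimplex ℝ κ).exists_isMaxOn ⟨x, hx⟩ hcont.continuousOn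
  refine (hmax hx).trans ?_
  obtain ⟨a, ha⟩ := Finite.exists_max z
  set M := ∑ a, ∑ b, c a b * z a * z b with hM
  set g := ∑ b, c a b * z b with hg
  have hg1 : g ≤ 1 := hc z hz a ha
  have hza : 0 < z a := by
    by_contra! h
    have : ∑ b, z b ≤ 0 := Finset.sum_nonpos fun b _ => (ha b).trans h
    linarith [hz.2]
  suffices M ≤ g by linarith
  have hpert : ∀ t : ℝ, 0 ≤ t → t ≤ z a →
      (1 + t) ^ 2 * M - 2 * t * (1 + t) * g + t ^ 2 * c a a ≤ M := by
    intro t ht hta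
    let w : κ → ℝ := fun b => (1 + t) * z b - t * (if b = a then 1 else 0)
    have hw : w ∈ stdSimplex ℝ κ := by
      refine ⟨fun b => ?_, ?_⟩
      · by_cases hb : b = a
        · subst hb
          simp only [w, if_true]
          nlinarith
        · simp only [w, if_neg hb]
          have := mul_nonneg (by linarith : 0 ≤ 1 + t) (hz.1 b)
          linarith
      · simp [w, Finset.sum_sub_distrib, ← Finset.mul_sum, hz.2]
    refine le_trans (le_of_eq ?_) (hmax hw)
    have e1 : ∑ p, ∑ q, c p q * w p * w q = ∑ p, ∑ q, ((1 + t) ^ 2 * (c p q * z p * z q)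
        - (if p = a then t * (1 + t) * (c p q * z q) else 0)
        - (if q = a then t * (1 + t) * (c p q * z p) else 0)
        + (if p = a then if q = a then t ^ 2 * c p q else 0 else 0)) := by
      refine Finset.sum_congr rfl fun p _ => Finset.sum_congr rfl fun q _ => ?_
      simp only [w]
      split_ifs <;> ring
    have e2 : ∑ p, ∑ q, (if p = a then t * (1 + t) * (c p q * z q) else 0) = t * (1 + t) * g := by
      rw [Finset.sum_comm]; simp [hg, Finset.mul_sum]
    have e3 : ∑ p, ∑ q, (if q = a then t * (1 + t) * (c p q * z p) else 0) = t * (1 + t) * g := by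
      simp [hg, Finset.mul_sum, hsymm a]
    have e4 : ∑ p, ∑ q, (if p = a then if q = a then t ^ 2 * c p q else 0 else 0)
        = t ^ 2 * c a a := by
      rw [Finset.sum_comm]; simp
    show _ = ∑ p, ∑ q, c p q * w p * w q
    rw [e1]
    simp only [Finset.sum_add_distrib, Finset.sum_sub_distrib, e2, e3, e4, ← Finset.mul_sum, ← hM]
    ring
  by_contra! hlt
  have hK : 0 < |M - 2 * g + c a a| + 1 := by positivity
  set K := |M - 2 * g + c a a| + 1
  obtain ⟨t, ht0, hta, htK⟩ : ∃ t : ℝ, 0 < t ∧ t ≤ z a ∧ t * K < 2 * (M - g) := by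
    refine ⟨min (z a) ((M - g) / K), lt_min hza (div_pos (by linarith) hK), min_le_left _ _, ?_⟩
    calc _ ≤ (M - g) / K * K := by gcongr; exact min_le_right _ _
      _ = M - g := div_mul_cancel₀ _ hK.ne'
      _ < _ := by linarith
  have h1 := hpert t ht0.le hta
  have h2 : -K ≤ M - 2 * g + c a a := by
    have := neg_abs_le (M - 2 * g + c a a)
    simp only [K]; linarith
  have h3 : 0 < t * (2 * (M - g) - t * K) := mul_pos ht0 (by linarith)
  nlinarith [mul_le_mul_of_nonneg_left h2 (sq_nonneg t)]

lemma sum_frobSq_commutator_le_one_of_orthogonal {ι κ : Type*} [Fintype ι] [DecidableEq ι]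
    [Fintype κ] [Nonempty κ] (B : κ → Matrix ι ι ℝ) (hB : ∀ a, (B a).IsSymm)
    (hBorth : ∀ a b, a ≠ b → (B a * (B b).transpose).trace = 0)
    (hBnorm : ∀ a, frobSq (B a) ≤ 1) (x : κ → ℝ) (hx : x ∈ stdSimplex ℝ κ) :
    ∑ a, ∑ b, frobSq (B a * B b - B b * B a) * x a * x b ≤ 1 := by
  classical
  refine quadratic_le_one_on_stdSimplex (fun a b => frobSq (B a * B b - B b * B a))
    (fun a b => by
      rw [← neg_sub, ← neg_one_smul ℝ (B b * B a - B a * B b), frobSq_smul]; norm_num)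
    (fun x hx a ha => by
      have h1 := sum_frobSq_commutator_le (B a) (hB a) (hBnorm a)
        (fun b : {b // b ≠ a} => B b) (fun b => hB b)
        (fun b b' hb => hBorth _ _ fun h => hb (Subtype.ext h)) (fun b => hBnorm b)
        (fun b => x b) (x a) (fun b => hx.1 b) (fun b => ha b) (hx.1 a)
      have h2 : ∑ b : {b // b ≠ a}, x b * frobSq (B b) ≤ ∑ b : {b // b ≠ a}, x b :=
        Finset.sum_le_sum fun b _ => mul_le_of_le_one_right (hx.1 b) (hBnorm b)
      have h3 : ∀ f : κ → ℝ, ∑ b, f b = f a + ∑ b : {b // b ≠ a}, f b := fun f =>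
        Fintype.sum_eq_add_sum_subtype_ne f a
      have h4 := hx.2
      rw [h3] at h4
      rw [h3, sub_self, frobSq_zero, zero_mul, zero_add]
      simp only [mul_comm _ (x _)]
      linarith) x hx

lemma sum_frobSq_commutator_le_of_orthogonal {ι κ : Type*} [Fintype ι] [DecidableEq ι] [Fintype κ]
    (A : κ → Matrix ι ι ℝ) (hA : ∀ a, (A a).IsSymm)
    (horth : ∀ a b, a ≠ b → (A a * (A b).transpose).trace = 0) :
    ∑ a, ∑ b, frobSq (A a * A b - A b * A a) ≤ (∑ a, frobSq (A a)) ^ 2 := by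
  classical
  obtain ⟨r, hr⟩ : ∃ r : κ → ℝ, ∀ a, r a ^ 2 = frobSq (A a) :=
    ⟨fun a => Real.sqrt (frobSq (A a)), fun a => Real.sq_sqrt (frobSq_nonneg _)⟩
  let B : κ → Matrix ι ι ℝ := fun a => (r a)⁻¹ • A a
  have hAB : ∀ a, A a = r a • B a := by
    intro a
    by_cases h : r a = 0
    · have h0 : frobSq (A a) = 0 := by rw [← hr, h]; simp
      rw [h, zero_smul]
      ext i j
      have h1 := (Finset.sum_eq_zero_iff_of_nonneg
        (fun i _ => Finset.sum_nonneg fun j _ => sq_nonneg (A a i j))).mp h0 i (Finset.mem_univ _)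
      have h2 := (Finset.sum_eq_zero_iff_of_nonneg
        (fun j _ => sq_nonneg (A a i j))).mp h1 j (Finset.mem_univ _)
      simpa using h2
    · simp [B, smul_smul, h]
  have hB : ∀ a, (B a).IsSymm := fun a => (hA a).smul _
  have hBorth : ∀ a b, a ≠ b → (B a * (B b).transpose).trace = 0 := by
    intro a b hab
    simp [B, horth a b hab]
  have hBnorm : ∀ a, frobSq (B a) ≤ 1 := by
    intro a
    simp only [B, frobSq_smul, inv_pow, hr]
    exact inv_mul_le_one
  have hcomm : ∀ a b, frobSq (A a * A b - A b * A a)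
      = frobSq (B a * B b - B b * B a) * r a ^ 2 * r b ^ 2 := by
    intro a b
    have : A a * A b - A b * A a = (r a * r b) • (B a * B b - B b * B a) := by
      rw [hAB a, hAB b]
      simp only [smul_mul_assoc, mul_smul_comm, smul_smul, smul_sub, mul_comm (r b)]
    rw [this, frobSq_smul]
    ring
  rcases (Finset.sum_nonneg fun a (_ : a ∈ Finset.univ) => frobSq_nonneg (A a)).eq_or_lt with h | h
  · have : ∀ a, r a ^ 2 = 0 := fun a => by
      rw [hr]
      exact (Finset.sum_eq_zero_iff_of_nonneg fun a _ => frobSq_nonneg (A a)).mp h.symm a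
        (Finset.mem_univ _)
    simp only [hcomm, this]
    simp
    positivity
  set S := ∑ a, frobSq (A a) with hS
  have : Nonempty κ := by
    by_contra hne
    rw [not_nonempty_iff] at hne
    simp [hS] at h
  have key := sum_frobSq_commutator_le_one_of_orthogonal B hB hBorth hBnorm
    (fun a => r a ^ 2 / S)
    ⟨fun a => div_nonneg (sq_nonneg _) h.le, by
      rw [← Finset.sum_div, div_eq_one_iff_eq h.ne']
      exact Finset.sum_congr rfl fun a _ => hr a⟩
  have hkey : ∑ a, ∑ b, frobSq (B a * B b - B b * B a) * (r a ^ 2 / S) * (r b ^ 2 / S)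
      = (∑ a, ∑ b, frobSq (A a * A b - A b * A a)) / S ^ 2 := by
    simp only [hcomm, Finset.sum_div]
    refine Finset.sum_congr rfl fun a _ => Finset.sum_congr rfl fun b _ => ?_
    field_simp
  rw [hkey, div_le_one (by positivity)] at key
  exact key

/-- The DDVV inequality for symmetric matrices. -/
lemma sum_frobSq_commutator_le_sq {ι κ : Type*} [Fintype ι] [DecidableEq ι] [Fintype κ]
    [DecidableEq κ] (M : κ → Matrix ι ι ℝ) (hM : ∀ a, (M a).IsSymm) :
    ∑ a, ∑ b, frobSq (M a * M b - M b * M a) ≤ (∑ a, frobSq (M a)) ^ 2 := by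
  let G : Matrix κ κ ℝ := Matrix.of fun a b => (M a * (M b).transpose).trace
  have hG : G.IsSymm := by
    ext a b
    simp only [G, Matrix.transpose_apply, Matrix.of_apply]
    rw [← Matrix.trace_transpose, Matrix.transpose_mul, Matrix.transpose_transpose]
  obtain ⟨P, g, hP, -, hPG⟩ := exists_orthogonal_diagonalization G hG
  let A : κ → Matrix ι ι ℝ := fun a => ∑ b, P b a • M b
  have hgram : ∀ a b, (A a * (A b).transpose).trace = (P.transpose * G * P) a b := by
    intro a b
    simp only [A, G, transpose_mul_mul_apply, Matrix.transpose_sum, Matrix.sum_mul,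
      Matrix.trace_sum, Matrix.transpose_smul, smul_mul_assoc, mul_smul_comm, Matrix.trace_smul,
      Matrix.of_apply, smul_eq_mul, Finset.mul_sum]
    refine Finset.sum_congr rfl fun p _ => Finset.sum_congr rfl fun q _ => ?_
    ring
  have h := sum_frobSq_commutator_le_of_orthogonal A
    (fun a => by
      simp only [A, Matrix.IsSymm, Matrix.transpose_sum, Matrix.transpose_smul, (hM _).eq])
    (fun a b hab => by rw [hgram, hPG, Matrix.diagonal_apply_ne _ hab])
  have hnorm : ∑ a, frobSq (A a) = ∑ a, frobSq (M a) := by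
    have : ∑ a, frobSq (A a) = (P.transpose * G * P).trace := by
      simp only [frobSq_eq_trace, hgram]
      rfl
    rw [this, Matrix.mul_assoc, Matrix.trace_mul_comm, Matrix.mul_assoc, hP, Matrix.mul_one]
    simp only [frobSq_eq_trace, G, Matrix.trace, Matrix.diag_apply, Matrix.of_apply]
  have hswap : ∀ N : κ → κ → Matrix ι ι ℝ, ∑ a, ∑ b, frobSq (N a b)
      = ∑ i, ∑ j, frobSq (Matrix.of fun a b => N a b i j) := by
    intro N
    simp only [frobSq, Matrix.of_apply]
    calc _ = ∑ a, ∑ i, ∑ b, ∑ j, N a b i j ^ 2 :=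
          Finset.sum_congr rfl fun a _ => Finset.sum_comm
      _ = ∑ i, ∑ a, ∑ b, ∑ j, N a b i j ^ 2 := Finset.sum_comm
      _ = ∑ i, ∑ a, ∑ j, ∑ b, N a b i j ^ 2 :=
          Finset.sum_congr rfl fun i _ => Finset.sum_congr rfl fun a _ => Finset.sum_comm
      _ = _ := Finset.sum_congr rfl fun i _ => Finset.sum_comm
  have hcomm : ∑ a, ∑ b, frobSq (A a * A b - A b * A a)
      = ∑ a, ∑ b, frobSq (M a * M b - M b * M a) := by
    rw [hswap, hswap fun a b => M a * M b - M b * M a]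
    refine Finset.sum_congr rfl fun i _ => Finset.sum_congr rfl fun j _ => ?_
    refine Eq.trans ?_ (frobSq_conj P _ hP)
    congr 1
    ext a b
    have h1 : A a * A b - A b * A a = ∑ q, ∑ p, (P p a * P q b) • (M p * M q - M q * M p) := by
      simp only [smul_sub, Finset.sum_sub_distrib]
      congr 1
      · simp only [A, Matrix.sum_mul, Matrix.mul_sum, smul_mul_assoc, mul_smul_comm, smul_smul,
          Finset.smul_sum]
        exact Finset.sum_congr rfl fun q _ => Finset.sum_congr rfl fun p _ => by rw [mul_comm (P p a)]
      · rw [Finset.sum_comm]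
        simp only [A, Matrix.sum_mul, Matrix.mul_sum, smul_mul_assoc, mul_smul_comm, smul_smul,
          Finset.smul_sum]
    rw [transpose_mul_mul_apply]
    simp only [Matrix.of_apply, h1, Matrix.sum_apply, Matrix.smul_apply, smul_eq_mul]
    refine Finset.sum_congr rfl fun q _ => Finset.sum_congr rfl fun p _ => ?_
    ring
  rwa [hcomm, hnorm] at h

lemma inner_shapeOp (e : OrthonormalBasis (Fin n) ℝ V) (β : V →ₗ[ℝ] V →ₗ[ℝ] W) (η : W)
    (x y : V) : ⟪shapeOp β η x, y⟫ = ⟪β x y, η⟫ := by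
  have h : ∃ A : V →ₗ[ℝ] V, ∀ x y : V, ⟪β x y, η⟫ = ⟪A x, y⟫ := by
    refine ⟨∑ j, ((innerₗ W η) ∘ₗ (β.flip (e j))).smulRight (e j), fun x y => ?_⟩
    conv_lhs => rw [← e.sum_repr' y]
    simp only [map_sum, map_smul, sum_inner, LinearMap.sum_apply, LinearMap.smulRight_apply,
      LinearMap.comp_apply, LinearMap.flip_apply, innerₗ_apply_apply, real_inner_smul_left]
    exact Finset.sum_congr rfl fun j _ => by rw [mul_comm, real_inner_comm η]
  rw [shapeOp, dif_pos h]
  exact (h.choose_spec x y).symm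

/-- The matrix of the shape operator `A_η(β)` in the basis `e`. -/
noncomputable def shapeMatrix (e : OrthonormalBasis (Fin n) ℝ V) (β : V →ₗ[ℝ] V →ₗ[ℝ] W)
    (η : W) : Matrix (Fin n) (Fin n) ℝ :=
  Matrix.of fun i j => ⟪β (e i) (e j), η⟫

lemma shapeMatrix_isSymm (e : OrthonormalBasis (Fin n) ℝ V) {β : V →ₗ[ℝ] V →ₗ[ℝ] W}
    (hβ : IsSymmBil β) (η : W) : (shapeMatrix e β η).IsSymm := by
  ext i j
  simp [shapeMatrix, hβ (e j) (e i)]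

lemma inner_shapeOp_shapeOp (e : OrthonormalBasis (Fin n) ℝ V) {β : V →ₗ[ℝ] V →ₗ[ℝ] W}
    (hβ : IsSymmBil β) (η ζ : W) (i j : Fin n) :
    ⟪shapeOp β η (shapeOp β ζ (e i)), e j⟫ = (shapeMatrix e β ζ * shapeMatrix e β η) i j := by
  rw [inner_shapeOp e, hβ, ← inner_shapeOp e, real_inner_comm, ← e.sum_inner_mul_inner,
    Matrix.mul_apply]
  refine Finset.sum_congr rfl fun k _ => ?_
  rw [inner_shapeOp e, ← real_inner_comm (e k), inner_shapeOp e, hβ (e j)]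
  rfl

lemma sum_norm_sq_commutator_shapeOp (e : OrthonormalBasis (Fin n) ℝ V)
    {β : V →ₗ[ℝ] V →ₗ[ℝ] W} (hβ : IsSymmBil β) (η ζ : W) :
    ∑ i, ‖(shapeOp β η ∘ₗ shapeOp β ζ - shapeOp β ζ ∘ₗ shapeOp β η) (e i)‖ ^ 2
      = frobSq (shapeMatrix e β ζ * shapeMatrix e β η
          - shapeMatrix e β η * shapeMatrix e β ζ) := by
  refine Finset.sum_congr rfl fun i _ => ?_
  rw [← e.sum_sq_inner_left]
  refine Finset.sum_congr rfl fun j _ => ?_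
  rw [LinearMap.sub_apply, LinearMap.comp_apply, LinearMap.comp_apply, inner_sub_left,
    inner_shapeOp_shapeOp e hβ, inner_shapeOp_shapeOp e hβ, Matrix.sub_apply]

lemma sum_frobSq_shapeMatrix (e : OrthonormalBasis (Fin n) ℝ V)
    (ξ : OrthonormalBasis (Fin m) ℝ W) (β : V →ₗ[ℝ] V →ₗ[ℝ] W) :
    ∑ a, frobSq (shapeMatrix e β (ξ a)) = ∑ i, ∑ j, ‖β (e i) (e j)‖ ^ 2 := by
  simp only [frobSq, ← ξ.sum_sq_inner_left]
  rw [Finset.sum_comm]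
  exact Finset.sum_congr rfl fun i _ => Finset.sum_comm

lemma sum_diag_eq_smul_meanCurv (hn : n ≠ 0) (e : OrthonormalBasis (Fin n) ℝ V)
    (β : V →ₗ[ℝ] V →ₗ[ℝ] W) : ∑ i, β (e i) (e i) = (n : ℝ) • meanCurv e β := by
  rw [meanCurv, smul_smul, mul_inv_cancel₀ (by exact_mod_cast hn), one_smul]

lemma sum_ric (hn : n ≠ 0) (c : ℝ) (e : OrthonormalBasis (Fin n) ℝ V)
    (β : V →ₗ[ℝ] V →ₗ[ℝ] W) :
    ∑ i, ric c e β (e i) (e i) = n * (n - 1) * c + n ^ 2 * ‖meanCurv e β‖ ^ 2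
      - ∑ i, ∑ j, ‖β (e i) (e j)‖ ^ 2 := by
  simp only [ric, Finset.sum_sub_distrib, Finset.sum_add_distrib, ← Finset.mul_sum, ← inner_sum,
    sum_diag_eq_smul_meanCurv hn, real_inner_smul_right, real_inner_self_eq_norm_sq,
    e.norm_eq_one]
  simp
  ring

lemma frobSq_sub_smul_one {ι : Type*} [Fintype ι] [DecidableEq ι] (A : Matrix ι ι ℝ) (t : ℝ) :
    frobSq (A - t • (1 : Matrix ι ι ℝ))
      = frobSq A - 2 * t * A.trace + Fintype.card ι * t ^ 2 := by
  have h : (A - t • (1 : Matrix ι ι ℝ)) * (A - t • (1 : Matrix ι ι ℝ)).transpose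
      = A * A.transpose - t • A - t • A.transpose + t ^ 2 • (1 : Matrix ι ι ℝ) := by
    simp only [Matrix.transpose_sub, Matrix.transpose_smul, Matrix.transpose_one, sub_mul, mul_sub,
      smul_mul_assoc, mul_smul_comm, one_mul, mul_one, smul_sub, smul_smul, sq]
    abel
  rw [frobSq_eq_trace, h, frobSq_eq_trace]
  simp
  ring

/-- the algebraic DDVV inequality `ρ_c(β) ≤ c + H_β² − ρ⊥(β)`. -/
theorem stmt1 (n m : ℕ) (hn : 2 ≤ n) (hm : 1 ≤ m)
    {V W : Type*} [NormedAddCommGroup V] [InnerProductSpace ℝ V]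
    [NormedAddCommGroup W] [InnerProductSpace ℝ W]
    (e : OrthonormalBasis (Fin n) ℝ V) (ξ : OrthonormalBasis (Fin m) ℝ W)
    (β : V →ₗ[ℝ] V →ₗ[ℝ] W) (hβ : IsSymmBil β) (c : ℝ) :
    rho c e β ≤ c + ‖meanCurv e β‖ ^ 2 - rhoPerp e ξ β := by
  have hn0 : n ≠ 0 := by lia
  have hn2 : (2 : ℝ) ≤ n := by exact_mod_cast hn
  set H := meanCurv e β with hH
  let M : Fin m → Matrix (Fin n) (Fin n) ℝ := fun a => shapeMatrix e β (ξ a)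
  let N : Fin m → Matrix (Fin n) (Fin n) ℝ := fun a =>
    M a - ⟪H, ξ a⟫ • (1 : Matrix (Fin n) (Fin n) ℝ)
  have hN : ∀ a, (N a).IsSymm := fun a =>
    (shapeMatrix_isSymm e hβ _).sub (Matrix.isSymm_one.smul _)
  have hcomm : ∀ a b, N a * N b - N b * N a = M a * M b - M b * M a := by
    intro a b
    simp only [N, sub_mul, mul_sub, smul_mul_assoc, mul_smul_comm, one_mul, mul_one]
    rw [smul_sub, smul_sub, smul_comm ⟪H, ξ a⟫]
    abel
  have htrace : ∀ a, (M a).trace = n * ⟪H, ξ a⟫ := by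
    intro a
    rw [← real_inner_smul_left, ← sum_diag_eq_smul_meanCurv hn0, sum_inner]
    rfl
  set F := ∑ i, ∑ j, ‖β (e i) (e j)‖ ^ 2 with hF
  have hnorm : ∑ a, frobSq (N a) = F - n * ‖H‖ ^ 2 := by
    simp only [N, frobSq_sub_smul_one, htrace, Finset.sum_add_distrib, Finset.sum_sub_distrib]
    rw [sum_frobSq_shapeMatrix, ← hF, ← ξ.sum_sq_inner_left H, Finset.mul_sum, add_comm,
      add_sub_left_comm, sub_eq_add_neg F, ← Finset.sum_sub_distrib, ← Finset.sum_neg_distrib]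
    congr 1
    refine Finset.sum_congr rfl fun a _ => ?_
    rw [Fintype.card_fin]
    ring
  have hsqrt : Real.sqrt (∑ a, ∑ b, ∑ i, ‖(shapeOp β (ξ a) ∘ₗ shapeOp β (ξ b)
      - shapeOp β (ξ b) ∘ₗ shapeOp β (ξ a)) (e i)‖ ^ 2) ≤ F - n * ‖H‖ ^ 2 := by
    have hnonneg : 0 ≤ F - n * ‖H‖ ^ 2 := by
      rw [← hnorm]
      exact Finset.sum_nonneg fun a _ => frobSq_nonneg _
    refine Real.sqrt_le_iff.mpr ⟨hnonneg, ?_⟩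
    have h := sum_frobSq_commutator_le_sq N hN
    simp only [hcomm, hnorm] at h
    rw [Finset.sum_comm] at h
    simpa only [sum_norm_sq_commutator_shapeOp e hβ] using h
  have hpos : (0 : ℝ) < n * (n - 1) := mul_pos (by linarith) (by linarith)
  rw [rho, rhoPerp, sum_ric hn0, ← hH, ← hF, inv_mul_eq_div, inv_mul_eq_div, le_sub_iff_add_le,
    ← add_div, div_le_iff₀ hpos]
  linarith

end Paper
end

section
/- Assume n ≥ 3. For every β ∈ Sym(V×V,W), every c ∈ ℝ and every k ∈ {1, …, n−1}, the inequality ρ_{c,k}(β) ≤ c + H_β² − ρ⊥(β) holds; moreover, equality holds for some k ∈ {1, …, n−1} if and only if β is umbilical. -/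
open scoped RealInnerProductSpace BigOperators
open MeasureTheory Classical

namespace Paper

variable {V W : Type*} [NormedAddCommGroup V] [InnerProductSpace ℝ V]
  [NormedAddCommGroup W] [InnerProductSpace ℝ W]

variable {n m : ℕ}

lemma sum_mul_mul_le_sq_sum {κ : Type*} (b : κ → κ → ℝ) (hb : ∀ i j, b i j = b j i) (s : Finset κ)
    (h : ∀ t ⊆ s, ∀ i ∈ t, ∑ j ∈ t, b i j ≤ t.card) (p : κ → ℝ) (hp : ∀ i, 0 ≤ p i) :
    ∑ i ∈ s, ∑ j ∈ s, p i * p j * b i j ≤ (∑ i ∈ s, p i) ^ 2 := by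
  classical
  induction s using Finset.strongInduction generalizing p with
  | H s ih =>
    rcases s.eq_empty_or_nonempty with rfl | hs
    · simp
    obtain ⟨z, hz, hmin⟩ := s.exists_min_image p hs
    set t := p z with ht
    set q : κ → ℝ := fun i => max (p i - t) 0 with hq
    have hpq : ∀ i ∈ s, p i = q i + t := fun i hi => by
      rw [hq]; simp only; rw [max_eq_left (by linarith [hmin i hi])]; ring
    have hqz : q z = 0 := by simp [hq, ht]
    have ih' := ih (s.erase z) (Finset.erase_ssubset hz)
      (fun u hu => h u (hu.trans (Finset.erase_subset _ _))) q (fun i => le_max_right _ _)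
    rw [Finset.sum_erase _ hqz, Finset.sum_erase _ (by simp [hqz])] at ih'
    have ih'' : ∑ i ∈ s, ∑ j ∈ s, q i * q j * b i j ≤ (∑ i ∈ s, q i) ^ 2 := by
      refine le_of_eq_of_le (Finset.sum_congr rfl fun i _ => ?_) ih'
      exact (Finset.sum_erase _ (by simp [hqz])).symm
    have h₁ : ∑ i ∈ s, q i * ∑ j ∈ s, b i j ≤ ∑ i ∈ s, q i * s.card :=
      Finset.sum_le_sum fun i hi =>
        mul_le_mul_of_nonneg_left (h s subset_rfl i hi) (le_max_right _ _)
    have h₂ : ∑ i ∈ s, ∑ j ∈ s, b i j ≤ s.card * s.card := by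
      refine (Finset.sum_le_sum fun i hi => h s subset_rfl i hi).trans ?_
      simp
    have h₃ : ∑ i ∈ s, p i = ∑ i ∈ s, q i + s.card * t := by
      rw [Finset.sum_congr rfl hpq, Finset.sum_add_distrib]; simp
    have h₅ : ∑ i ∈ s, ∑ j ∈ s, q j * b i j = ∑ i ∈ s, q i * ∑ j ∈ s, b i j := by
      rw [Finset.sum_comm]
      simp only [Finset.mul_sum]
      exact Finset.sum_congr rfl fun i _ => Finset.sum_congr rfl fun j _ => by rw [hb]
    have h₄ : ∑ i ∈ s, ∑ j ∈ s, p i * p j * b i j = ∑ i ∈ s, ∑ j ∈ s, q i * q j * b i j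
        + 2 * t * ∑ i ∈ s, q i * ∑ j ∈ s, b i j + t ^ 2 * ∑ i ∈ s, ∑ j ∈ s, b i j := by
      have : 2 * t * ∑ i ∈ s, q i * ∑ j ∈ s, b i j = t * (∑ i ∈ s, q i * ∑ j ∈ s, b i j) +
          t * ∑ i ∈ s, ∑ j ∈ s, q j * b i j := by rw [h₅]; ring
      rw [this]
      simp only [Finset.mul_sum, ← Finset.sum_add_distrib]
      refine Finset.sum_congr rfl fun i hi => Finset.sum_congr rfl fun j hj => ?_
      rw [hpq i hi, hpq j hj]
      ring
    rw [← Finset.sum_mul] at h₁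
    rw [h₃, h₄]
    have ht0 : 0 ≤ t := hp z
    nlinarith [mul_le_mul_of_nonneg_left h₁ ht0, mul_le_mul_of_nonneg_left h₂ (sq_nonneg t)]

section Frobenius

open Matrix

/-- The symmetric matrix of Frobenius norm one supported at the entries `(i, j)`, `(j, i)`. -/
noncomputable def symmUnit {ι : Type*} [DecidableEq ι] (i j : ι) : Matrix ι ι ℝ :=
  (√2)⁻¹ • (single i j 1 + single j i 1)

lemma transpose_symmUnit {ι : Type*} [DecidableEq ι] (i j : ι) :
    (symmUnit i j)ᵀ = symmUnit i j := by
  simp [symmUnit, add_comm]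

lemma transpose_sum_smul {ι κ : Type*} [Fintype κ] {A : κ → Matrix ι ι ℝ}
    (hA : ∀ a, (A a)ᵀ = A a) (r : κ → ℝ) :
    (∑ a, r a • A a)ᵀ = ∑ a, r a • A a := by
  simp [transpose_sum, hA]

variable {ι κ : Type*} [Fintype ι]

/-- The Frobenius inner product of two real matrices. -/
noncomputable def frob (A B : Matrix ι ι ℝ) : ℝ := trace (Aᵀ * B)

lemma frob_eq_sum (A B : Matrix ι ι ℝ) : frob A B = ∑ i, ∑ j, A i j * B i j := by
  simp only [frob, trace, diag, mul_apply, transpose_apply]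
  exact Finset.sum_comm

lemma frob_add_left (A B C : Matrix ι ι ℝ) : frob (A + B) C = frob A C + frob B C := by
  simp [frob, add_mul]

lemma frob_add_right (A B C : Matrix ι ι ℝ) : frob A (B + C) = frob A B + frob A C := by
  simp [frob, mul_add]

lemma frob_sub_left (A B C : Matrix ι ι ℝ) : frob (A - B) C = frob A C - frob B C := by
  simp [frob, sub_mul]

lemma frob_sub_right (A B C : Matrix ι ι ℝ) : frob A (B - C) = frob A B - frob A C := by
  simp [frob, mul_sub]

lemma frob_smul_left (c : ℝ) (A B : Matrix ι ι ℝ) : frob (c • A) B = c * frob A B := by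
  simp [frob]

lemma frob_smul_right (c : ℝ) (A B : Matrix ι ι ℝ) : frob A (c • B) = c * frob A B := by
  simp [frob]

lemma frob_sum_left (s : Finset κ) (A : κ → Matrix ι ι ℝ) (B : Matrix ι ι ℝ) :
    frob (∑ a ∈ s, A a) B = ∑ a ∈ s, frob (A a) B := by
  simp [frob, transpose_sum, Finset.sum_mul, trace_sum]

lemma frob_sum_right (s : Finset κ) (A : κ → Matrix ι ι ℝ) (B : Matrix ι ι ℝ) :
    frob B (∑ a ∈ s, A a) = ∑ a ∈ s, frob B (A a) := by
  simp [frob, Finset.mul_sum, trace_sum]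

lemma frob_comm (A B : Matrix ι ι ℝ) : frob A B = frob B A := by
  simp only [frob_eq_sum, mul_comm]

lemma frob_self_nonneg (A : Matrix ι ι ℝ) : 0 ≤ frob A A := by
  rw [frob_eq_sum]
  exact Finset.sum_nonneg fun i _ => Finset.sum_nonneg fun j _ => mul_self_nonneg _

lemma eq_zero_of_frob_self_eq_zero {A : Matrix ι ι ℝ} (h : frob A A = 0) : A = 0 := by
  have hi : ∀ i, 0 ≤ ∑ j, A i j * A i j := fun i => Finset.sum_nonneg fun j _ => mul_self_nonneg _
  rw [frob_eq_sum] at h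
  ext i j
  have h₁ := (Finset.sum_eq_zero_iff_of_nonneg fun i _ => hi i).1 h i (Finset.mem_univ i)
  have h₂ := (Finset.sum_eq_zero_iff_of_nonneg fun j _ => mul_self_nonneg (A i j)).1 h₁ j
    (Finset.mem_univ j)
  simpa using h₂

/-- The squared Frobenius norm of the commutator of two matrices. -/
noncomputable def commSq (A B : Matrix ι ι ℝ) : ℝ := frob (A * B - B * A) (A * B - B * A)

lemma commSq_comm (A B : Matrix ι ι ℝ) : commSq A B = commSq B A := by
  rw [commSq, commSq, ← neg_sub (B * A), ← neg_one_smul ℝ, frob_smul_left, frob_smul_right]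
  ring

lemma commSq_self (A : Matrix ι ι ℝ) : commSq A A = 0 := by
  simp [commSq, frob]

lemma commSq_nonneg (A B : Matrix ι ι ℝ) : 0 ≤ commSq A B := frob_self_nonneg _

lemma commSq_smul_left (c : ℝ) (A B : Matrix ι ι ℝ) :
    commSq (c • A) B = c ^ 2 * commSq A B := by
  have : (c • A) * B - B * (c • A) = c • (A * B - B * A) := by
    simp [smul_sub]
  rw [commSq, this, frob_smul_left, frob_smul_right, commSq]
  ring

lemma commSq_smul_right (c : ℝ) (A B : Matrix ι ι ℝ) :
    commSq A (c • B) = c ^ 2 * commSq A B := by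
  rw [commSq_comm, commSq_smul_left, commSq_comm]

lemma commSq_parallelogram (A B C : Matrix ι ι ℝ) :
    commSq (A + B) C + commSq (A - B) C = 2 * commSq A C + 2 * commSq B C := by
  have h₁ : (A + B) * C - C * (A + B) = (A * C - C * A) + (B * C - C * B) := by
    noncomm_ring
  have h₂ : (A - B) * C - C * (A - B) = (A * C - C * A) - (B * C - C * B) := by
    noncomm_ring
  simp only [commSq, h₁, h₂, frob_add_left, frob_add_right, frob_sub_left (A * C - C * A),
    frob_sub_right _ (A * C - C * A)]
  ring

/-- Conjugation of a matrix by `U`. -/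
noncomputable def conj (U A : Matrix ι ι ℝ) : Matrix ι ι ℝ := Uᵀ * A * U

lemma transpose_conj {U A : Matrix ι ι ℝ} (hA : Aᵀ = A) : (conj U A)ᵀ = conj U A := by
  simp [conj, hA, Matrix.mul_assoc]

lemma conj_sub (U A B : Matrix ι ι ℝ) : conj U (A - B) = conj U A - conj U B := by
  simp [conj, Matrix.mul_sub, Matrix.sub_mul]

lemma conj_smul (c : ℝ) (U A : Matrix ι ι ℝ) : conj U (c • A) = c • conj U A := by
  simp [conj]

lemma conj_mul [DecidableEq ι] {U : Matrix ι ι ℝ} (hU : U * Uᵀ = 1) (A B : Matrix ι ι ℝ) :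
    conj U A * conj U B = conj U (A * B) := by
  calc Uᵀ * A * U * (Uᵀ * B * U) = Uᵀ * A * (U * Uᵀ) * B * U := by simp only [Matrix.mul_assoc]
    _ = _ := by simp [hU, conj, Matrix.mul_assoc]

lemma conj_conj_transpose [DecidableEq ι] {U : Matrix ι ι ℝ} (hU : Uᵀ * U = 1)
    (A : Matrix ι ι ℝ) : conj U (conj Uᵀ A) = A := by
  calc Uᵀ * (Uᵀᵀ * A * Uᵀ) * U = (Uᵀ * U) * A * (Uᵀ * U) := by
        simp only [Matrix.mul_assoc, transpose_transpose]
    _ = A := by simp [hU]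

lemma frob_conj [DecidableEq ι] {U : Matrix ι ι ℝ} (hU : U * Uᵀ = 1) (A B : Matrix ι ι ℝ) :
    frob (conj U A) (conj U B) = frob A B := by
  have h : (conj U A)ᵀ = conj U Aᵀ := by simp [conj, Matrix.mul_assoc]
  rw [frob, h, conj_mul hU, conj, trace_mul_comm, ← Matrix.mul_assoc, hU, Matrix.one_mul, frob]

lemma commSq_conj [DecidableEq ι] {U : Matrix ι ι ℝ} (hU : U * Uᵀ = 1) (A B : Matrix ι ι ℝ) :
    commSq (conj U A) (conj U B) = commSq A B := by
  rw [commSq, conj_mul hU, conj_mul hU, ← conj_sub, frob_conj hU, commSq]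

lemma exists_conj_eq_diagonal [DecidableEq ι] {X : Matrix ι ι ℝ} (hX : Xᵀ = X) :
    ∃ (U : Matrix ι ι ℝ) (η : ι → ℝ), U * Uᵀ = 1 ∧ Uᵀ * U = 1 ∧ conj U X = diagonal η := by
  have hH : X.IsHermitian := by simpa [IsHermitian] using hX
  set U : Matrix ι ι ℝ := hH.eigenvectorUnitary.val with hUdef
  have hstar : star U = Uᵀ := by simp [star_eq_conjTranspose]
  have h₁ : U * Uᵀ = 1 := by
    rw [← hstar]; exact Unitary.coe_mul_star_self _
  have h₂ : Uᵀ * U = 1 := by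
    rw [← hstar]; exact Unitary.coe_star_mul_self _
  refine ⟨U, hH.eigenvalues, h₁, h₂, ?_⟩
  have h := hH.spectral_theorem
  rw [Unitary.conjStarAlgAut_apply] at h
  have h' : X = conj Uᵀ (diagonal hH.eigenvalues) := by
    rw [conj, transpose_transpose, ← hstar]
    exact h
  conv_lhs => rw [h']
  exact conj_conj_transpose h₂ _

lemma sum_max_sub_sq_le_two (η : ι → ℝ) (hη : ∑ i, η i ^ 2 = 1) :
    ∑ i, ∑ j, max ((η i - η j) ^ 2 - 1) 0 ≤ 2 := by
  classical
  have hsum : ∀ s : Finset ι, ∑ i ∈ s, η i ^ 2 ≤ 1 := fun s => by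
    rw [← hη]
    exact Finset.sum_le_sum_of_subset_of_nonneg (Finset.subset_univ s) fun _ _ _ => sq_nonneg _
  have htriple : ∀ i j k, i ≠ j → i ≠ k → j ≠ k → η i ^ 2 + η j ^ 2 + η k ^ 2 ≤ 1 := by
    intro i j k hij hik hjk
    have := hsum {i, j, k}
    rw [Finset.sum_insert (by simp [hij, hik]), Finset.sum_insert (by simp [hjk]),
      Finset.sum_singleton] at this
    linarith
  have hquad : ∀ i j k l, i ≠ j → i ≠ k → i ≠ l → j ≠ k → j ≠ l → k ≠ l →
      η i ^ 2 + η j ^ 2 + η k ^ 2 + η l ^ 2 ≤ 1 := by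
    intro i j k l hij hik hil hjk hjl hkl
    have := hsum {i, j, k, l}
    rw [Finset.sum_insert (by simp [hij, hik, hil]), Finset.sum_insert (by simp [hjk, hjl]),
      Finset.sum_insert (by simp [hkl]), Finset.sum_singleton] at this
    linarith
  -- Any two pairs at distance larger than one share an index.
  have hmeet : ∀ i j k l, 1 < (η i - η j) ^ 2 → 1 < (η k - η l) ^ 2 →
      k = i ∨ k = j ∨ l = i ∨ l = j := by
    intro i j k l h₁ h₂
    by_contra! h
    have hij : i ≠ j := by rintro rfl; norm_num at h₁
    have hkl : k ≠ l := by rintro rfl; norm_num at h₂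
    have := hquad i j k l hij h.1.symm h.2.2.1.symm h.2.1.symm h.2.2.2.symm hkl
    nlinarith [sq_nonneg (η i + η j), sq_nonneg (η k + η l)]
  have htri : ∀ i j k, 1 < (η i - η j) ^ 2 → 1 < (η j - η k) ^ 2 → ¬ 1 < (η k - η i) ^ 2 := by
    intro i j k h₁ h₂ h₃
    have hij : i ≠ j := by rintro rfl; norm_num at h₁
    have hjk : j ≠ k := by rintro rfl; norm_num at h₂
    have hik : i ≠ k := by rintro rfl; norm_num at h₃
    have := htriple i j k hij hik hjk
    nlinarith [sq_nonneg (η i + η j + η k)]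
  by_cases hex : ∃ a b, 1 < (η a - η b) ^ 2
  swap
  · push Not at hex
    have : ∑ i, ∑ j, max ((η i - η j) ^ 2 - 1) 0 = 0 :=
      Finset.sum_eq_zero fun i _ => Finset.sum_eq_zero fun j _ =>
        max_eq_right (by linarith [hex i j])
    linarith
  have hcenter : ∃ z, ∀ i j, 1 < (η i - η j) ^ 2 → i = z ∨ j = z := by
    obtain ⟨a, b, hab⟩ := hex
    by_cases ha : ∀ i j, 1 < (η i - η j) ^ 2 → i = a ∨ j = a
    · exact ⟨a, ha⟩
    push Not at ha
    obtain ⟨c, d, hcd, hca, hda⟩ := ha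
    obtain ⟨d, hbd, hda⟩ : ∃ d, 1 < (η b - η d) ^ 2 ∧ d ≠ a := by
      rcases hmeet a b c d hab hcd with h | h | h | h
      · exact absurd h hca
      · exact ⟨d, h ▸ hcd, hda⟩
      · exact absurd h hda
      · exact ⟨c, by rw [← h]; nlinarith, hca⟩
    refine ⟨b, fun p q hpq => ?_⟩
    by_contra! hb
    have h₁ := hmeet a b p q hab hpq
    have h₂ := hmeet b d p q hbd hpq
    have hmem : (p = a ∨ q = a) ∧ (p = d ∨ q = d) := by tauto
    rcases hmem with ⟨rfl | rfl, rfl | rfl⟩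
    · exact hda rfl
    · exact htri p b q hab hbd (by nlinarith)
    · exact htri q b p hab hbd hpq
    · exact hda rfl
  obtain ⟨z, hz⟩ := hcenter
  set f : ι → ℝ := fun j => max ((η z - η j) ^ 2 - 1) 0 with hf
  have hle : ∀ i j, max ((η i - η j) ^ 2 - 1) 0 ≤
      (if i = z then f j else 0) + (if j = z then f i else 0) := by
    intro i j
    have hf0 : ∀ j, 0 ≤ f j := fun j => le_max_right _ _
    by_cases h : 1 < (η i - η j) ^ 2
    · rcases hz i j h with rfl | rfl
      · rw [if_pos rfl]
        split_ifs <;> simp [hf]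
      · rw [if_pos rfl]
        have : max ((η i - η j) ^ 2 - 1) 0 = f i := by
          rw [hf]; congr 2; ring
        rw [this]
        split_ifs <;> simp [hf0]
    · rw [max_eq_right (by linarith)]
      split_ifs <;> simp [add_nonneg, hf0]
  have hstar : ∑ j, f j ≤ 1 := by
    set J := Finset.univ.filter fun j => 1 < (η z - η j) ^ 2 with hJ
    have h₁ : ∑ j, f j = ∑ j ∈ J, ((η z - η j) ^ 2 - 1) := by
      rw [hJ, Finset.sum_filter]
      refine Finset.sum_congr rfl fun j _ => ?_
      split_ifs with h
      · exact max_eq_left (by linarith)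
      · exact max_eq_right (by linarith)
    have hzJ : z ∉ J := by simp [hJ]
    have h₂ := hsum (insert z J)
    rw [Finset.sum_insert hzJ] at h₂
    have h₃ : (∑ j ∈ J, η j) ^ 2 ≤ J.card * ∑ j ∈ J, η j ^ 2 := sq_sum_le_card_mul_sum_sq
    have h₄ : ∑ j ∈ J, ((η z - η j) ^ 2 - 1) =
        J.card * η z ^ 2 - 2 * η z * ∑ j ∈ J, η j + ∑ j ∈ J, η j ^ 2 - J.card := by
      simp only [sub_sq, Finset.sum_sub_distrib, Finset.sum_add_distrib, Finset.sum_const,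
        nsmul_eq_mul, Finset.mul_sum, mul_one]
    rw [h₁, h₄]
    have hr : (0 : ℝ) ≤ J.card := Nat.cast_nonneg _
    nlinarith [sq_nonneg (η z + ∑ j ∈ J, η j), mul_le_mul_of_nonneg_left h₂ hr]
  calc _ ≤ ∑ i, ∑ j, ((if i = z then f j else 0) + (if j = z then f i else 0)) :=
        Finset.sum_le_sum fun i _ => Finset.sum_le_sum fun j _ => hle i j
    _ = ∑ j, f j + ∑ j, f j := by
        simp only [Finset.sum_add_distrib, Finset.sum_ite_eq', Finset.mem_univ, if_true]
        congr 1
        rw [Finset.sum_comm]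
        simp
    _ ≤ 2 := by linarith

section FiniteFamily

variable [Fintype κ]

lemma commSq_diagonal [DecidableEq ι] (η : ι → ℝ) (A : Matrix ι ι ℝ) :
    commSq (diagonal η) A = ∑ i, ∑ j, (η i - η j) ^ 2 * A i j ^ 2 := by
  rw [commSq, frob_eq_sum]
  refine Finset.sum_congr rfl fun i _ => Finset.sum_congr rfl fun j _ => ?_
  rw [Matrix.sub_apply, diagonal_mul, mul_diagonal]
  ring

lemma frob_diagonal_right [DecidableEq ι] (A : Matrix ι ι ℝ) (η : ι → ℝ) :
    frob A (diagonal η) = ∑ i, A i i * η i := by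
  rw [frob_eq_sum]
  refine Finset.sum_congr rfl fun i _ => ?_
  rw [Finset.sum_eq_single i] <;> simp +contextual [eq_comm]

lemma frob_symmUnit [DecidableEq ι] {A : Matrix ι ι ℝ} (hA : Aᵀ = A) (i j : ι) :
    frob A (symmUnit i j) = √2 * A i j := by
  have h : ∀ i j, frob A (single i j 1) = A i j := fun i j => by
    rw [frob_eq_sum, Finset.sum_eq_single i, Finset.sum_eq_single j] <;>
      simp +contextual [single_apply, eq_comm]
  have hs : A j i = A i j := congrFun (congrFun hA i) j
  have h2 : √2 * √2 = 2 := Real.mul_self_sqrt (by norm_num)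
  have h0 : √2 ≠ 0 := by positivity
  rw [symmUnit, frob_smul_right, frob_add_right, h, h, hs]
  field_simp
  linear_combination -A i j * h2

lemma frob_symmUnit_self [DecidableEq ι] {i j : ι} (hij : i ≠ j) :
    frob (symmUnit i j) (symmUnit i j) = 1 := by
  rw [frob_symmUnit (transpose_symmUnit i j)]
  simp [symmUnit, hij.symm]

lemma symmUnit_cube [DecidableEq ι] {i j : ι} (hij : i ≠ j) :
    symmUnit i j * symmUnit i j * symmUnit i j = (1 / 2 : ℝ) • symmUnit i j := by
  have h2 : (√2)⁻¹ * (√2)⁻¹ = 1 / 2 := by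
    rw [← mul_inv, Real.mul_self_sqrt (by norm_num)]; norm_num
  have h : (single i j (1 : ℝ) + single j i 1) * (single i j 1 + single j i 1) *
      (single i j 1 + single j i 1) = single i j 1 + single j i 1 := by
    simp [Matrix.mul_add, Matrix.add_mul, hij, hij.symm, add_comm]
  simp only [symmUnit, Matrix.smul_mul, Matrix.mul_smul, h, smul_smul, h2]
  rw [mul_comm]

lemma symmUnit_mulVec_single [DecidableEq ι] {i j k : ι} (hi : k ≠ i) (hj : k ≠ j) :
    symmUnit i j *ᵥ Pi.single k 1 = 0 := by
  ext l
  simp [symmUnit, hi.symm, hj.symm]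

/-- The quadratic form `Y ↦ ∑ a, ⟪A a, Y⟫²` is bounded by `μ ‖Y‖²`. -/
def FrobBound (A : κ → Matrix ι ι ℝ) (μ : ℝ) : Prop :=
  ∀ Y : Matrix ι ι ℝ, Yᵀ = Y → ∑ a, frob (A a) Y ^ 2 ≤ μ * frob Y Y

section Diagonal

variable [DecidableEq ι] {A : κ → Matrix ι ι ℝ} {μ : ℝ} {η : ι → ℝ}

lemma FrobBound.two_mul_sum_sq_le (hμ : FrobBound A μ) (hA : ∀ a, (A a)ᵀ = A a) {i j : ι}
    (hij : i ≠ j) : 2 * ∑ a, A a i j ^ 2 ≤ μ := by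
  have h := hμ (symmUnit i j) (transpose_symmUnit i j)
  rw [frob_symmUnit_self hij, mul_one] at h
  simpa only [frob_symmUnit (hA _), mul_pow, ← Finset.mul_sum,
    Real.sq_sqrt (zero_le_two : (0 : ℝ) ≤ 2)] using h

lemma sum_frob_self_diagonal (η : ι → ℝ) : frob (diagonal η) (diagonal η) = ∑ i, η i ^ 2 := by
  simp [frob_diagonal_right, sq]

lemma frob_diagonal_sq_add (hη : ∑ i, η i ^ 2 = 1) (B : Matrix ι ι ℝ) :
    ∑ i, B i i ^ 2 = frob B (diagonal η) ^ 2 +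
      ∑ i, (B i i - frob B (diagonal η) * η i) ^ 2 := by
  have h : ∑ i, (B i i - frob B (diagonal η) * η i) ^ 2 = ∑ i, B i i ^ 2 -
      2 * frob B (diagonal η) * (∑ i, B i i * η i) +
      frob B (diagonal η) ^ 2 * ∑ i, η i ^ 2 := by
    simp only [Finset.mul_sum, ← Finset.sum_sub_distrib, ← Finset.sum_add_distrib]
    exact Finset.sum_congr rfl fun i _ => by ring
  rw [h, hη, ← frob_diagonal_right]
  ring

lemma sum_commSq_diagonal_sub (A : κ → Matrix ι ι ℝ) (η : ι → ℝ) :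
    ∑ a, commSq (diagonal η) (A a) - ∑ a, frob (A a) (A a) =
      ∑ i, ∑ j, ((η i - η j) ^ 2 - 1) * ∑ a, A a i j ^ 2 := by
  simp only [commSq_diagonal, frob_eq_sum, ← Finset.sum_sub_distrib, Finset.mul_sum]
  rw [Finset.sum_comm]
  refine Finset.sum_congr rfl fun i _ => ?_
  rw [Finset.sum_comm]
  exact Finset.sum_congr rfl fun j _ => Finset.sum_congr rfl fun a _ => by ring

/-- The gap in the pointwise estimate behind the commutator bound. -/
noncomputable def gap (A : κ → Matrix ι ι ℝ) (μ : ℝ) (η : ι → ℝ) (i j : ι) : ℝ :=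
  max ((η i - η j) ^ 2 - 1) 0 * (μ / 2) - (if i = j then ∑ a, A a i i ^ 2 else 0)
    - ((η i - η j) ^ 2 - 1) * ∑ a, A a i j ^ 2

lemma gap_nonneg (hA : ∀ a, (A a)ᵀ = A a) (hμ : FrobBound A μ) (i j : ι) :
    0 ≤ gap A μ η i j := by
  rw [gap]
  split_ifs with h
  · subst h
    simp
  · have h₁ := hμ.two_mul_sum_sq_le hA h
    have h₂ : 0 ≤ ∑ a, A a i j ^ 2 := Finset.sum_nonneg fun a _ => sq_nonneg _
    rcases le_total ((η i - η j) ^ 2 - 1) 0 with h₃ | h₃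
    · rw [max_eq_right h₃]
      nlinarith
    · rw [max_eq_left h₃]
      nlinarith

lemma sum_gap_add (hη : ∑ i, η i ^ 2 = 1) (htop : ∑ a, frob (A a) (diagonal η) ^ 2 = μ) :
    ∑ i, ∑ j, gap A μ η i j +
      ∑ a, ∑ i, (A a i i - frob (A a) (diagonal η) * η i) ^ 2 +
      (2 - ∑ i, ∑ j, max ((η i - η j) ^ 2 - 1) 0) * (μ / 2) =
      ∑ a, frob (A a) (A a) - ∑ a, commSq (diagonal η) (A a) := by
  have h₁ : ∑ i, ∑ j, gap A μ η i j = (∑ i, ∑ j, max ((η i - η j) ^ 2 - 1) 0) * (μ / 2)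
      - ∑ i, ∑ a, A a i i ^ 2
      - (∑ a, commSq (diagonal η) (A a) - ∑ a, frob (A a) (A a)) := by
    rw [sum_commSq_diagonal_sub]
    simp only [gap, Finset.sum_sub_distrib, ← Finset.sum_mul, Finset.sum_ite_eq,
      Finset.mem_univ, if_true]
  have h₂ : ∑ i, ∑ a, A a i i ^ 2 =
      μ + ∑ a, ∑ i, (A a i i - frob (A a) (diagonal η) * η i) ^ 2 := by
    rw [Finset.sum_comm, ← htop, ← Finset.sum_add_distrib]
    exact Finset.sum_congr rfl fun a _ => frob_diagonal_sq_add hη (A a)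
  rw [h₁, h₂]
  ring

lemma sum_commSq_diagonal_le (hA : ∀ a, (A a)ᵀ = A a) (hμ : FrobBound A μ)
    (hη : ∑ i, η i ^ 2 = 1) (htop : ∑ a, frob (A a) (diagonal η) ^ 2 = μ) :
    ∑ a, commSq (diagonal η) (A a) ≤ ∑ a, frob (A a) (A a) := by
  have h := sum_gap_add hη htop
  have h₁ : 0 ≤ ∑ i, ∑ j, gap A μ η i j :=
    Finset.sum_nonneg fun i _ => Finset.sum_nonneg fun j _ => gap_nonneg hA hμ i j
  have h₂ : 0 ≤ ∑ a, ∑ i, (A a i i - frob (A a) (diagonal η) * η i) ^ 2 :=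
    Finset.sum_nonneg fun i _ => Finset.sum_nonneg fun j _ => sq_nonneg _
  have h₃ := sum_max_sub_sq_le_two η hη
  have h₄ : 0 ≤ μ := htop ▸ Finset.sum_nonneg fun a _ => sq_nonneg _
  nlinarith

lemma gap_eq_zero_of_eq (hA : ∀ a, (A a)ᵀ = A a) (hμ : FrobBound A μ)
    (hη : ∑ i, η i ^ 2 = 1) (htop : ∑ a, frob (A a) (diagonal η) ^ 2 = μ)
    (heq : ∑ a, commSq (diagonal η) (A a) = ∑ a, frob (A a) (A a)) :
    (∀ i j, gap A μ η i j = 0) ∧ ∀ a i, A a i i = frob (A a) (diagonal η) * η i := by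
  have h := sum_gap_add hη htop
  have h₀ : ∀ i, 0 ≤ ∑ j, gap A μ η i j :=
    fun i => Finset.sum_nonneg fun j _ => gap_nonneg hA hμ i j
  have h₀' : ∀ a, 0 ≤ ∑ i, (A a i i - frob (A a) (diagonal η) * η i) ^ 2 :=
    fun a => Finset.sum_nonneg fun j _ => sq_nonneg _
  have h₁ : 0 ≤ ∑ i, ∑ j, gap A μ η i j := Finset.sum_nonneg fun i _ => h₀ i
  have h₂ : 0 ≤ ∑ a, ∑ i, (A a i i - frob (A a) (diagonal η) * η i) ^ 2 :=
    Finset.sum_nonneg fun a _ => h₀' a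
  have h₃ := sum_max_sub_sq_le_two η hη
  have h₄ : 0 ≤ μ := htop ▸ Finset.sum_nonneg fun a _ => sq_nonneg _
  have h₅ : ∑ i, ∑ j, gap A μ η i j = 0 := by nlinarith
  have h₆ : ∑ a, ∑ i, (A a i i - frob (A a) (diagonal η) * η i) ^ 2 = 0 := by nlinarith
  refine ⟨fun i j => ?_, fun a i => ?_⟩
  · have := (Finset.sum_eq_zero_iff_of_nonneg fun i _ => h₀ i).1 h₅ i (Finset.mem_univ i)
    exact (Finset.sum_eq_zero_iff_of_nonneg fun j _ => gap_nonneg hA hμ i j).1 this j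
      (Finset.mem_univ j)
  · have := (Finset.sum_eq_zero_iff_of_nonneg fun a _ => h₀' a).1 h₆ a (Finset.mem_univ a)
    have := (Finset.sum_eq_zero_iff_of_nonneg fun j _ => sq_nonneg _).1 this i (Finset.mem_univ i)
    exact sub_eq_zero.1 (pow_eq_zero_iff two_ne_zero |>.1 this)

lemma exists_symmUnit_top (hA : ∀ a, (A a)ᵀ = A a) (hμ : FrobBound A μ) (hμ0 : 0 < μ)
    (hη : ∑ i, η i ^ 2 = 1) (htop : ∑ a, frob (A a) (diagonal η) ^ 2 = μ)
    (heq : ∑ a, commSq (diagonal η) (A a) = ∑ a, frob (A a) (A a)) :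
    ∃ i j, i ≠ j ∧ ∑ a, frob (A a) (symmUnit i j) ^ 2 = μ := by
  obtain ⟨hgap, hdiag⟩ := gap_eq_zero_of_eq hA hμ hη htop heq
  have hex : ∃ i j, i ≠ j ∧ 0 < ((η i - η j) ^ 2 - 1) * ∑ a, A a i j ^ 2 := by
    by_contra! hcon
    have h₁ : ∑ i, ∑ j, ((η i - η j) ^ 2 - 1) * ∑ a, A a i j ^ 2 ≤
        ∑ i, ∑ j, if i = j then - ∑ a, A a i i ^ 2 else 0 := by
      refine Finset.sum_le_sum fun i _ => Finset.sum_le_sum fun j _ => ?_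
      split_ifs with h
      · subst h
        simp
      · exact hcon i j h
    have h₂ : ∑ i, ∑ a, A a i i ^ 2 = μ := by
      rw [Finset.sum_comm, ← htop]
      refine Finset.sum_congr rfl fun a _ => ?_
      simp only [hdiag a, mul_pow, ← Finset.mul_sum, hη, mul_one]
    rw [← sum_commSq_diagonal_sub, heq, sub_self] at h₁
    simp only [Finset.sum_ite_eq, Finset.mem_univ, if_true, Finset.sum_neg_distrib, h₂] at h₁
    linarith
  obtain ⟨i, j, hij, hpos⟩ := hex
  refine ⟨i, j, hij, ?_⟩
  have hS : 0 ≤ ∑ a, A a i j ^ 2 := Finset.sum_nonneg fun a _ => sq_nonneg _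
  have hw : 0 < (η i - η j) ^ 2 - 1 := pos_of_mul_pos_left hpos hS
  have hg := hgap i j
  rw [gap, if_neg hij, max_eq_left hw.le, sub_zero, ← mul_sub] at hg
  have hS' : μ / 2 - ∑ a, A a i j ^ 2 = 0 := (mul_eq_zero.1 hg).resolve_left hw.ne'
  simp only [frob_symmUnit (hA _), mul_pow, ← Finset.mul_sum,
    Real.sq_sqrt (zero_le_two : (0 : ℝ) ≤ 2)]
  linarith

lemma apply_eq_zero_of_top (hA : ∀ a, (A a)ᵀ = A a) (hμ : FrobBound A μ)
    (hη : ∑ i, η i ^ 2 = 1) (htop : ∑ a, frob (A a) (diagonal η) ^ 2 = μ)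
    (heq : ∑ a, commSq (diagonal η) (A a) = ∑ a, frob (A a) (A a))
    (hlt : ∀ i, η i ^ 2 < 1) {k : ι} (hk : η k = 0) (a : κ) (j : ι) : A a j k = 0 := by
  obtain ⟨hgap, hdiag⟩ := gap_eq_zero_of_eq hA hμ hη htop heq
  by_cases hjk : j = k
  · rw [hjk, hdiag, hk, mul_zero]
  · have hw : (η j - η k) ^ 2 - 1 < 0 := by
      rw [hk, sub_zero]; linarith [hlt j]
    have hg := hgap j k
    rw [gap, if_neg hjk, max_eq_right hw.le, zero_mul, sub_zero, zero_sub, neg_eq_zero] at hg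
    have hS := (mul_eq_zero.1 hg).resolve_left hw.ne
    exact pow_eq_zero_iff two_ne_zero |>.1
      ((Finset.sum_eq_zero_iff_of_nonneg fun a _ => sq_nonneg _).1 hS a (Finset.mem_univ a))

end Diagonal

section Symmetric

variable {A : κ → Matrix ι ι ℝ} {μ : ℝ}

lemma FrobBound.conj [DecidableEq ι] {U : Matrix ι ι ℝ} (hU : U * Uᵀ = 1) (hU' : Uᵀ * U = 1)
    (hμ : FrobBound A μ) : FrobBound (fun a => conj U (A a)) μ := by
  intro Y hY
  have h := hμ (Paper.conj Uᵀ Y) (transpose_conj hY)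
  rw [← frob_conj hU, conj_conj_transpose hU'] at h
  simpa only [← frob_conj hU (A _), conj_conj_transpose hU'] using h

lemma mulVec_eq_zero_of_conj [DecidableEq ι] {U B : Matrix ι ι ℝ} (hU : U * Uᵀ = 1) {v : ι → ℝ}
    (h : conj U B *ᵥ v = 0) : B *ᵥ (U *ᵥ v) = 0 := by
  have : B *ᵥ (U *ᵥ v) = U *ᵥ (conj U B *ᵥ v) := by
    simp only [Paper.conj, mulVec_mulVec, ← Matrix.mul_assoc, hU, Matrix.one_mul]
  rw [this, h, mulVec_zero]

lemma mulVec_ne_zero_of_left_inverse [DecidableEq ι] {U U' : Matrix ι ι ℝ} (hU : U' * U = 1)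
    {v : ι → ℝ} (hv : v ≠ 0) : U *ᵥ v ≠ 0 := by
  intro h
  apply hv
  rw [← one_mulVec v, ← hU, ← mulVec_mulVec, h, mulVec_zero]

lemma sum_commSq_le_of_top (hA : ∀ a, (A a)ᵀ = A a) (hμ : FrobBound A μ)
    {X : Matrix ι ι ℝ} (hX : Xᵀ = X) (hX1 : frob X X = 1)
    (htop : ∑ a, frob (A a) X ^ 2 = μ) :
    ∑ a, commSq X (A a) ≤ ∑ a, frob (A a) (A a) := by
  classical
  obtain ⟨U, η, hU, hU', hd⟩ := exists_conj_eq_diagonal hX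
  have hη : ∑ i, η i ^ 2 = 1 := by
    rw [← sum_frob_self_diagonal, ← hd, frob_conj hU, hX1]
  have h := sum_commSq_diagonal_le (fun a => transpose_conj (U := U) (hA a)) (hμ.conj hU hU') hη
    (by simpa only [← hd, frob_conj hU] using htop)
  simpa only [← hd, frob_conj hU, commSq_conj hU] using h

lemma exists_top_cube_eq (hA : ∀ a, (A a)ᵀ = A a) (hμ : FrobBound A μ) (hμ0 : 0 < μ)
    (hι : 3 ≤ Fintype.card ι) {X : Matrix ι ι ℝ} (hX : Xᵀ = X) (hX1 : frob X X = 1)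
    (htop : ∑ a, frob (A a) X ^ 2 = μ)
    (heq : ∑ a, commSq X (A a) = ∑ a, frob (A a) (A a)) :
    ∃ E : Matrix ι ι ℝ, Eᵀ = E ∧ frob E E = 1 ∧ E * E * E = (1 / 2 : ℝ) • E ∧
      ∑ a, frob (A a) E ^ 2 = μ ∧ ∃ v : ι → ℝ, v ≠ 0 ∧ E *ᵥ v = 0 := by
  classical
  obtain ⟨U, η, hU, hU', hd⟩ := exists_conj_eq_diagonal hX
  have hη : ∑ i, η i ^ 2 = 1 := by
    rw [← sum_frob_self_diagonal, ← hd, frob_conj hU, hX1]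
  obtain ⟨i, j, hij, hS⟩ := exists_symmUnit_top (fun a => transpose_conj (U := U) (hA a))
    (hμ.conj hU hU') hμ0 hη (by simpa only [← hd, frob_conj hU] using htop)
    (by simpa only [← hd, frob_conj hU, commSq_conj hU] using heq)
  have hUt : Uᵀ * Uᵀᵀ = 1 := by rw [transpose_transpose, hU']
  obtain ⟨k, hk⟩ : ∃ k, k ∉ ({i, j} : Finset ι) := by
    by_contra! hcon
    have h₁ := Finset.card_le_card (show Finset.univ ⊆ ({i, j} : Finset ι) from fun k _ => hcon k)
    have h₂ := Finset.card_le_two (a := i) (b := j)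
    rw [Finset.card_univ] at h₁
    omega
  simp only [Finset.mem_insert, Finset.mem_singleton, not_or] at hk
  refine ⟨Paper.conj Uᵀ (symmUnit i j), transpose_conj (transpose_symmUnit i j), ?_, ?_, ?_,
    U *ᵥ Pi.single k 1, ?_, ?_⟩
  · rw [frob_conj hUt, frob_symmUnit_self hij]
  · rw [conj_mul hUt, conj_mul hUt, symmUnit_cube hij, conj_smul]
  · rw [← hS]
    refine Finset.sum_congr rfl fun a _ => ?_
    rw [← frob_conj hU (A a), conj_conj_transpose hU']
  · exact mulVec_ne_zero_of_left_inverse hU' (by simp)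
  · apply mulVec_eq_zero_of_conj hU
    rw [conj_conj_transpose hU', symmUnit_mulVec_single hk.1 hk.2]

lemma exists_mulVec_eq_zero_of_top (hA : ∀ a, (A a)ᵀ = A a) (hμ : FrobBound A μ)
    {E : Matrix ι ι ℝ} (hE : Eᵀ = E) (hE1 : frob E E = 1) (hE3 : E * E * E = (1 / 2 : ℝ) • E)
    (hE0 : ∃ v : ι → ℝ, v ≠ 0 ∧ E *ᵥ v = 0) (htop : ∑ a, frob (A a) E ^ 2 = μ)
    (heq : ∑ a, commSq E (A a) = ∑ a, frob (A a) (A a)) :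
    ∃ v : ι → ℝ, v ≠ 0 ∧ ∀ a, A a *ᵥ v = 0 := by
  classical
  obtain ⟨U, η, hU, hU', hd⟩ := exists_conj_eq_diagonal hE
  have hη : ∑ i, η i ^ 2 = 1 := by
    rw [← sum_frob_self_diagonal, ← hd, frob_conj hU, hE1]
  have hlt : ∀ i, η i ^ 2 < 1 := by
    intro i
    have h : diagonal η * diagonal η * diagonal η = (1 / 2 : ℝ) • diagonal η := by
      rw [← hd, conj_mul hU, conj_mul hU, hE3, conj_smul]
    have hi := congrFun (congrFun h i) i
    simp only [diagonal_mul_diagonal, diagonal_apply_eq, Matrix.smul_apply, smul_eq_mul] at hi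
    have hi' : η i * (η i ^ 2 - 1 / 2) = 0 := by linear_combination hi
    rcases mul_eq_zero.1 hi' with h | h
    · rw [h]; norm_num
    · linarith
  obtain ⟨v, hv, hEv⟩ := hE0
  have hv' : Uᵀ *ᵥ v ≠ 0 := mulVec_ne_zero_of_left_inverse hU hv
  obtain ⟨k, hk⟩ := Function.ne_iff.1 hv'
  have hηk : η k = 0 := by
    have h : diagonal η *ᵥ (Uᵀ *ᵥ v) = 0 := by
      rw [← hd, Paper.conj, mulVec_mulVec, Matrix.mul_assoc, hU, Matrix.mul_one, ← mulVec_mulVec,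
        hEv, mulVec_zero]
    have := congrFun h k
    rw [mulVec_diagonal] at this
    exact (mul_eq_zero.1 this).resolve_right hk
  refine ⟨U *ᵥ Pi.single k 1, mulVec_ne_zero_of_left_inverse hU' (by simp), fun a => ?_⟩
  apply mulVec_eq_zero_of_conj hU
  ext j
  rw [mulVec_single_one]
  exact apply_eq_zero_of_top (fun a => transpose_conj (U := U) (hA a)) (hμ.conj hU hU') hη
    (by simpa only [← hd, frob_conj hU] using htop)
    (by simpa only [← hd, frob_conj hU, commSq_conj hU] using heq) hlt hηk a j

/-- Bessel's inequality for a family of pairwise orthogonal matrices. -/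
lemma frob_bessel (horth : ∀ a b, a ≠ b → frob (A a) (A b) = 0)
    (hle : ∀ a, frob (A a) (A a) ≤ μ) (Y : Matrix ι ι ℝ) :
    frob (μ • Y - ∑ a, frob (A a) Y • A a) (μ • Y - ∑ a, frob (A a) Y • A a) ≤
      μ * (μ * frob Y Y - ∑ a, frob (A a) Y ^ 2) := by
  set Z := ∑ a, frob (A a) Y • A a with hZ
  have h₁ : frob Z Y = ∑ a, frob (A a) Y ^ 2 := by
    simp only [hZ, frob_sum_left, frob_smul_left, sq]
  have h₂ : frob Z Z ≤ μ * ∑ a, frob (A a) Y ^ 2 := by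
    have h₃ : ∀ a, frob (A a) Z = frob (A a) Y * frob (A a) (A a) := by
      intro a
      simp only [hZ, frob_sum_right, frob_smul_right]
      exact Finset.sum_eq_single a (fun b _ hb => by rw [horth a b hb.symm, mul_zero]) (by simp)
    have h₄ : frob Z Z = ∑ a, frob (A a) Y * frob (A a) Z := by
      conv_lhs => rw [hZ, frob_sum_left]
      simp only [frob_smul_left, ← hZ]
    rw [h₄, Finset.mul_sum]
    refine Finset.sum_le_sum fun a _ => ?_
    rw [h₃]
    nlinarith [hle a, sq_nonneg (frob (A a) Y)]
  have h₅ : frob Y Z = frob Z Y := frob_comm _ _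
  simp only [frob_sub_left, frob_sub_right, frob_smul_left, frob_smul_right]
  rw [h₅, h₁]
  linarith

lemma frobBound_of_orthogonal (horth : ∀ a b, a ≠ b → frob (A a) (A b) = 0) (hμ0 : 0 < μ)
    (hle : ∀ a, frob (A a) (A a) ≤ μ) : FrobBound A μ := by
  intro Y _
  have h := (frob_self_nonneg _).trans (frob_bessel horth hle Y)
  exact sub_nonneg.1 (nonneg_of_mul_nonneg_right h hμ0)

lemma smul_eq_sum_of_top (horth : ∀ a b, a ≠ b → frob (A a) (A b) = 0)
    (hle : ∀ a, frob (A a) (A a) ≤ μ) {E : Matrix ι ι ℝ} (hE1 : frob E E = 1)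
    (htop : ∑ a, frob (A a) E ^ 2 = μ) : μ • E = ∑ a, frob (A a) E • A a := by
  have h := frob_bessel horth hle E
  rw [hE1, htop, mul_one, sub_self, mul_zero] at h
  exact sub_eq_zero.1 (eq_zero_of_frob_self_eq_zero (le_antisymm h (frob_self_nonneg _)))

end Symmetric

section Orthogonalization

lemma frob_rotate (A : κ → Matrix ι ι ℝ) (R : Matrix κ κ ℝ) (c d : κ) :
    frob (∑ a, R a c • A a) (∑ a, R a d • A a) = conj R (of fun a b => frob (A a) (A b)) c d := by
  simp only [frob_sum_left, frob_sum_right, frob_smul_left, frob_smul_right, Paper.conj,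
    mul_apply, transpose_apply, of_apply, Finset.sum_mul, Finset.mul_sum]
  exact Finset.sum_congr rfl fun _ _ => Finset.sum_congr rfl fun _ _ => by ring

variable [DecidableEq κ] {R : Matrix κ κ ℝ}

lemma sum_frob_rotate (hR : R * Rᵀ = 1) (A : κ → Matrix ι ι ℝ) :
    ∑ c, frob (∑ a, R a c • A a) (∑ a, R a c • A a) = ∑ a, frob (A a) (A a) := by
  set Γ : Matrix κ κ ℝ := of fun a b => frob (A a) (A b)
  calc _ = trace (conj R Γ) := Finset.sum_congr rfl fun c _ => frob_rotate A R c c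
    _ = trace Γ := by rw [Paper.conj, trace_mul_comm, ← Matrix.mul_assoc, hR, Matrix.one_mul]
    _ = _ := rfl

lemma sum_commSq_rotate (hR : R * Rᵀ = 1) (A : κ → Matrix ι ι ℝ) (Y : Matrix ι ι ℝ) :
    ∑ c, commSq Y (∑ a, R a c • A a) = ∑ a, commSq Y (A a) := by
  have h := sum_frob_rotate hR fun a => Y * A a - A a * Y
  simp only [commSq, ← h]
  refine Finset.sum_congr rfl fun c _ => ?_
  have : Y * (∑ a, R a c • A a) - (∑ a, R a c • A a) * Y =
      ∑ a, R a c • (Y * A a - A a * Y) := by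
    simp only [Finset.mul_sum, Finset.sum_mul, ← Finset.sum_sub_distrib, smul_sub,
      Matrix.mul_smul, Matrix.smul_mul]
  rw [this]

lemma sum_sum_commSq_rotate (hR : R * Rᵀ = 1) (A : κ → Matrix ι ι ℝ) :
    ∑ c, ∑ d, commSq (∑ a, R a c • A a) (∑ a, R a d • A a) = ∑ a, ∑ b, commSq (A a) (A b) := by
  simp only [sum_commSq_rotate hR A]
  rw [Finset.sum_comm]
  refine (Finset.sum_congr rfl fun b _ => ?_).trans Finset.sum_comm
  simp only [commSq_comm _ (A b), sum_commSq_rotate hR A]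

lemma exists_orthogonal_rotation (A : κ → Matrix ι ι ℝ) :
    ∃ R : Matrix κ κ ℝ, R * Rᵀ = 1 ∧
      (∀ c d, c ≠ d → frob (∑ a, R a c • A a) (∑ a, R a d • A a) = 0) ∧
      ∀ a, A a = ∑ c, R a c • ∑ b, R b c • A b := by
  set Γ : Matrix κ κ ℝ := of fun a b => frob (A a) (A b)
  have hΓt : Γᵀ = Γ := by
    ext a b
    exact frob_comm _ _
  obtain ⟨R, p, hR, -, hd⟩ := exists_conj_eq_diagonal hΓt
  refine ⟨R, hR, fun c d hcd => ?_, fun a => ?_⟩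
  · rw [frob_rotate, hd, diagonal_apply_ne _ hcd]
  · have h : ∀ b, ∑ c, R a c * R b c = if a = b then 1 else 0 := by
      intro b
      have := congrFun (congrFun hR a) b
      simpa only [mul_apply, transpose_apply, one_apply] using this
    simp only [Finset.smul_sum, smul_smul]
    rw [Finset.sum_comm]
    simp only [← Finset.sum_smul, h, ite_smul, one_smul, zero_smul, Finset.sum_ite_eq,
      Finset.mem_univ, if_true]

end Orthogonalization

lemma sum_sum_commSq_le_of_orthogonal {A : κ → Matrix ι ι ℝ} (hA : ∀ a, (A a)ᵀ = A a)
    (horth : ∀ a b, a ≠ b → frob (A a) (A b) = 0) :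
    ∑ a, ∑ b, commSq (A a) (A b) ≤ (∑ a, frob (A a) (A a)) ^ 2 := by
  classical
  set p : κ → ℝ := fun a => frob (A a) (A a) with hp
  have hp0 : ∀ a, 0 ≤ p a := fun a => frob_self_nonneg _
  set X : κ → Matrix ι ι ℝ := fun a => (√(p a))⁻¹ • A a with hX
  have hXA : ∀ a, A a = √(p a) • X a := by
    intro a
    rcases (hp0 a).eq_or_lt with h | h
    · rw [← h, Real.sqrt_zero, zero_smul]
      exact eq_zero_of_frob_self_eq_zero h.symm
    · rw [hX, smul_smul, mul_inv_cancel₀ (Real.sqrt_pos.2 h).ne', one_smul]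
  have hXt : ∀ a, (X a)ᵀ = X a := fun a => by rw [hX]; simp [hA a]
  have hXself : ∀ a, 0 < p a → frob (X a) (X a) = 1 := by
    intro a ha
    simp only [hX, frob_smul_left, frob_smul_right]
    rw [← mul_assoc, ← mul_inv, Real.mul_self_sqrt ha.le]
    exact inv_mul_cancel₀ ha.ne'
  have hXorth : ∀ a b, a ≠ b → frob (X a) (X b) = 0 := by
    intro a b hab
    simp only [hX, frob_smul_left, frob_smul_right, horth a b hab, mul_zero]
  set s : Finset κ := Finset.univ.filter fun a => 0 < p a with hs
  have key : ∀ t ⊆ s, ∀ i ∈ t, ∑ j ∈ t, commSq (X i) (X j) ≤ t.card := by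
    intro t ht i hi
    have hpos : ∀ j ∈ t, 0 < p j := fun j hj => (Finset.mem_filter.1 (ht hj)).2
    set Y : κ → Matrix ι ι ℝ := fun j => if j ∈ t then X j else 0 with hY
    have hYt : ∀ j, (Y j)ᵀ = Y j := by
      intro j
      simp only [hY]
      split_ifs
      · exact hXt j
      · exact transpose_zero
    have hYself : ∀ j, frob (Y j) (Y j) = if j ∈ t then 1 else 0 := by
      intro j
      simp only [hY]
      split_ifs with h
      · exact hXself j (hpos j h)
      · simp [frob]
    have hYorth : ∀ a b, a ≠ b → frob (Y a) (Y b) = 0 := by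
      intro a b hab
      simp only [hY]
      split_ifs
      · exact hXorth a b hab
      all_goals simp [frob]
    have hYi : Y i = X i := if_pos hi
    have hYi1 : frob (X i) (X i) = 1 := hXself i (hpos i hi)
    have htop : ∑ j, frob (Y j) (X i) ^ 2 = 1 := by
      rw [← hYi, Finset.sum_eq_single i (fun j _ hj => by rw [hYorth j i hj]; norm_num) (by simp),
        hYi, hYi1, one_pow]
    have h := sum_commSq_le_of_top hYt
      (frobBound_of_orthogonal hYorth one_pos fun j => by rw [hYself]; split_ifs <;> norm_num)
      (hXt i) hYi1 htop
    simp only [hYself, Finset.sum_ite_mem, Finset.univ_inter, Finset.sum_const, nsmul_eq_mul,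
      mul_one] at h
    refine le_of_eq_of_le ?_ h
    rw [← Finset.sum_subset (Finset.subset_univ t)
      (fun j _ hj => by simp [hY, hj, commSq, frob])]
    exact Finset.sum_congr rfl fun j hj => by simp [hY, hj]
  have h := sum_mul_mul_le_sq_sum (fun i j => commSq (X i) (X j)) (fun i j => commSq_comm _ _) s
    key p hp0
  have hsum : ∀ f : κ → ℝ, (∀ a, p a = 0 → f a = 0) → ∑ a ∈ s, f a = ∑ a, f a := by
    intro f hf
    refine Finset.sum_subset (Finset.subset_univ s) fun a _ ha => hf a ?_
    rw [hs, Finset.mem_filter, not_and] at ha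
    exact le_antisymm (not_lt.1 (ha (Finset.mem_univ a))) (hp0 a)
  rw [hsum p fun a ha => ha, hsum _ fun a ha => by simp [ha]] at h
  refine le_of_eq_of_le (Finset.sum_congr rfl fun a _ => ?_) h
  rw [hsum _ fun b hb => by simp [hb]]
  refine Finset.sum_congr rfl fun b _ => ?_
  conv_lhs => rw [hXA a, hXA b]
  rw [commSq_smul_left, commSq_smul_right, Real.sq_sqrt (hp0 a), Real.sq_sqrt (hp0 b)]
  ring

/-- The commutator inequality of the normal scalar curvature conjecture. -/
theorem sum_sum_commSq_le {A : κ → Matrix ι ι ℝ} (hA : ∀ a, (A a)ᵀ = A a) :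
    ∑ a, ∑ b, commSq (A a) (A b) ≤ (∑ a, frob (A a) (A a)) ^ 2 := by
  classical
  obtain ⟨R, hR, horth, -⟩ := exists_orthogonal_rotation A
  have h := sum_sum_commSq_le_of_orthogonal (fun c => transpose_sum_smul hA fun a => R a c) horth
  rwa [sum_sum_commSq_rotate hR, sum_frob_rotate hR] at h

lemma sum_commSq_le_of_eq {A : κ → Matrix ι ι ℝ} (hA : ∀ a, (A a)ᵀ = A a)
    (heq : ∑ a, ∑ b, commSq (A a) (A b) = (∑ a, frob (A a) (A a)) ^ 2)
    {Y : Matrix ι ι ℝ} (hY : Yᵀ = Y) :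
    ∑ a, commSq Y (A a) ≤ (∑ a, frob (A a) (A a)) * frob Y Y := by
  set τ := ∑ a, frob (A a) (A a) with hτ
  have key : ∀ s : ℝ, 0 < s → 2 * ∑ a, commSq Y (A a) ≤ 2 * (τ * frob Y Y) + s * frob Y Y ^ 2 := by
    intro s hs
    have h := sum_sum_commSq_le (A := fun o : Option κ => o.elim (√s • Y) A) (by
      rintro (_ | a)
      · simp [hY]
      · exact hA a)
    simp only [Fintype.sum_option, Option.elim_none, Option.elim_some, commSq_smul_left,
      commSq_smul_right, commSq_self, frob_smul_left, frob_smul_right, commSq_comm _ Y,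
      Finset.sum_add_distrib, heq, Real.sq_sqrt hs.le, ← Finset.mul_sum, ← hτ] at h
    rw [← mul_assoc (√s), Real.mul_self_sqrt hs.le] at h
    refine le_of_mul_le_mul_left ?_ hs
    nlinarith
  by_contra! hlt
  have hY0 : 0 ≤ frob Y Y := frob_self_nonneg Y
  set δ := ∑ a, commSq Y (A a) - τ * frob Y Y with hδ
  have hδ0 : 0 < δ := sub_pos.2 hlt
  have h := key (δ / (frob Y Y ^ 2 + 1)) (by positivity)
  have h' : δ / (frob Y Y ^ 2 + 1) * frob Y Y ^ 2 ≤ δ := by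
    rw [div_mul_eq_mul_div, div_le_iff₀ (by positivity)]
    nlinarith
  linarith

lemma commSq_sum_eq_of_eq {A : κ → Matrix ι ι ℝ} (hA : ∀ a, (A a)ᵀ = A a)
    (heq : ∑ a, ∑ b, commSq (A a) (A b) = (∑ a, frob (A a) (A a)) ^ 2) (r : κ → ℝ) :
    ∑ a, commSq (∑ b, r b • A b) (A a) =
      (∑ a, frob (A a) (A a)) * frob (∑ b, r b • A b) (∑ b, r b • A b) := by
  classical
  set τ := ∑ a, frob (A a) (A a) with hτ
  have hle : ∀ Y : Matrix ι ι ℝ, Yᵀ = Y → 0 ≤ τ * frob Y Y - ∑ a, commSq Y (A a) :=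
    fun Y hY => sub_nonneg.2 (sum_commSq_le_of_eq hA heq hY)
  have hself : ∀ b, τ * frob (A b) (A b) - ∑ a, commSq (A b) (A a) = 0 := by
    have h : ∑ b, (τ * frob (A b) (A b) - ∑ a, commSq (A b) (A a)) = 0 := by
      rw [Finset.sum_sub_distrib, ← Finset.mul_sum, ← hτ, heq]
      ring
    exact fun b => (Finset.sum_eq_zero_iff_of_nonneg fun b _ => hle _ (hA b)).1 h b
      (Finset.mem_univ b)
  suffices h : ∀ s : Finset κ, (∑ b ∈ s, r b • A b)ᵀ = ∑ b ∈ s, r b • A b ∧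
      τ * frob (∑ b ∈ s, r b • A b) (∑ b ∈ s, r b • A b) -
        ∑ a, commSq (∑ b ∈ s, r b • A b) (A a) = 0 by
    exact (sub_eq_zero.1 (h Finset.univ).2).symm
  intro s
  induction s using Finset.induction_on with
  | empty => simp [frob, commSq]
  | insert b s hb ih =>
    rw [Finset.sum_insert hb]
    set Z := ∑ b ∈ s, r b • A b
    have hbt : (r b • A b)ᵀ = r b • A b := by simp [hA b]
    have h₁ : (r b • A b + Z)ᵀ = r b • A b + Z := by rw [transpose_add, hbt, ih.1]
    have h₂ : (r b • A b - Z)ᵀ = r b • A b - Z := by rw [transpose_sub, hbt, ih.1]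
    refine ⟨h₁, ?_⟩
    have h₃ : τ * frob (r b • A b) (r b • A b) - ∑ a, commSq (r b • A b) (A a) = 0 := by
      simp only [frob_smul_left, frob_smul_right, commSq_smul_left, ← Finset.mul_sum]
      linear_combination r b ^ 2 * hself b
    have h₄ := hle _ h₁
    have h₅ := hle _ h₂
    have h₆ : ∑ a, commSq (r b • A b + Z) (A a) + ∑ a, commSq (r b • A b - Z) (A a) =
        2 * ∑ a, commSq (r b • A b) (A a) + 2 * ∑ a, commSq Z (A a) := by
      simp only [Finset.mul_sum, ← Finset.sum_add_distrib, commSq_parallelogram]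
    have h₇ : frob (r b • A b + Z) (r b • A b + Z) + frob (r b • A b - Z) (r b • A b - Z) =
        2 * frob (r b • A b) (r b • A b) + 2 * frob Z Z := by
      rw [frob_add_left, frob_sub_left, frob_add_right, frob_add_right, frob_sub_right,
        frob_sub_right]
      ring
    have h₈ := ih.2
    have h₉ := congrArg (τ * ·) h₇
    linarith

lemma exists_mulVec_eq_zero_of_orthogonal {A : κ → Matrix ι ι ℝ} (hι : 3 ≤ Fintype.card ι)
    (hA : ∀ a, (A a)ᵀ = A a) (horth : ∀ a b, a ≠ b → frob (A a) (A b) = 0)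
    (heq : ∑ a, ∑ b, commSq (A a) (A b) = (∑ a, frob (A a) (A a)) ^ 2) :
    ∃ v : ι → ℝ, v ≠ 0 ∧ ∀ a, A a *ᵥ v = 0 := by
  classical
  by_cases hzero : ∀ a, A a = 0
  · have : Nonempty ι := Fintype.card_pos_iff.1 (by omega)
    exact ⟨fun _ => 1, fun h => one_ne_zero (congrFun h (Classical.arbitrary ι)),
      fun a => by rw [hzero a, zero_mulVec]⟩
  push Not at hzero
  obtain ⟨a₀, ha₀⟩ := hzero
  obtain ⟨z, -, hz⟩ := Finset.univ.exists_max_image (fun a => frob (A a) (A a))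
    ⟨a₀, Finset.mem_univ _⟩
  set μ := frob (A z) (A z) with hμdef
  have hle : ∀ a, frob (A a) (A a) ≤ μ := fun a => hz a (Finset.mem_univ a)
  have hμ0 : 0 < μ := by
    refine lt_of_lt_of_le ((frob_self_nonneg _).lt_of_ne fun h => ?_) (hle a₀)
    exact ha₀ (eq_zero_of_frob_self_eq_zero h.symm)
  have hμ := frobBound_of_orthogonal horth hμ0 hle
  have hsqrt : (√μ)⁻¹ * (√μ)⁻¹ * μ = 1 := by
    rw [← mul_inv, Real.mul_self_sqrt hμ0.le, inv_mul_cancel₀ hμ0.ne']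
  have hX : ∀ r : κ → ℝ, frob (∑ b, r b • A b) (∑ b, r b • A b) = 1 →
      ∑ a, commSq (∑ b, r b • A b) (A a) = ∑ a, frob (A a) (A a) := fun r hr => by
    rw [commSq_sum_eq_of_eq hA heq, hr, mul_one]
  have hXz : ∑ b, (if b = z then (√μ)⁻¹ else 0) • A b = (√μ)⁻¹ • A z := by
    simp [ite_smul]
  have hX1 : frob ((√μ)⁻¹ • A z) ((√μ)⁻¹ • A z) = 1 := by
    rw [frob_smul_left, frob_smul_right, ← mul_assoc]
    exact hsqrt
  obtain ⟨E, hE, hE1, hE3, htop, hE0⟩ := exists_top_cube_eq hA hμ hμ0 hι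
    (X := (√μ)⁻¹ • A z) (by simp [hA z]) hX1 (by
      rw [Finset.sum_eq_single z (fun b _ hb => by simp [frob_smul_right, horth b z hb]) (by simp),
        frob_smul_right]
      linear_combination μ * hsqrt) (by
      rw [← hXz]
      exact hX _ (by rw [hXz, hX1]))
  have hspan : E = ∑ a, (μ⁻¹ * frob (A a) E) • A a := by
    have h := smul_eq_sum_of_top horth hle hE1 htop
    simp only [mul_smul, ← Finset.smul_sum, ← h]
    rw [smul_smul, inv_mul_cancel₀ hμ0.ne', one_smul]
  refine exists_mulVec_eq_zero_of_top hA hμ hE hE1 hE3 hE0 htop ?_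
  have h := hX (fun a => μ⁻¹ * frob (A a) E)
  simp only [← hspan] at h
  exact h hE1

theorem exists_mulVec_eq_zero_of_eq {A : κ → Matrix ι ι ℝ} (hι : 3 ≤ Fintype.card ι)
    (hA : ∀ a, (A a)ᵀ = A a)
    (heq : ∑ a, ∑ b, commSq (A a) (A b) = (∑ a, frob (A a) (A a)) ^ 2) :
    ∃ v : ι → ℝ, v ≠ 0 ∧ ∀ a, A a *ᵥ v = 0 := by
  classical
  obtain ⟨R, hR, horth, hback⟩ := exists_orthogonal_rotation A
  obtain ⟨v, hv, h⟩ := exists_mulVec_eq_zero_of_orthogonal hι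
    (fun c => transpose_sum_smul hA fun a => R a c) horth
    (by rw [sum_sum_commSq_rotate hR, sum_frob_rotate hR, heq])
  refine ⟨v, hv, fun a => ?_⟩
  rw [hback a, sum_mulVec]
  exact Finset.sum_eq_zero fun c _ => by rw [smul_mulVec, h c, smul_zero]

end FiniteFamily

lemma commSq_sub_smul_one [DecidableEq ι] (A B : Matrix ι ι ℝ) (s t : ℝ) :
    commSq (A - s • 1) (B - t • 1) = commSq A B := by
  have : (A - s • 1) * (B - t • 1) - (B - t • 1) * (A - s • 1) = A * B - B * A := by
    simp only [Matrix.sub_mul, Matrix.mul_sub, Matrix.smul_mul, Matrix.mul_smul, Matrix.one_mul,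
      Matrix.mul_one]
    module
  rw [commSq, this, commSq]

end Frobenius

section Geometry

lemma mean_prefix_le (μ : Fin n → ℝ) (hμ : Monotone μ) {k : ℕ} (hk : 1 ≤ k) (hkn : k < n) :
    (k : ℝ)⁻¹ * ∑ i ∈ Finset.univ.filter (fun i : Fin n => (i : ℕ) < k), μ i
        ≤ (n : ℝ)⁻¹ * ∑ i, μ i ∧
      ((k : ℝ)⁻¹ * ∑ i ∈ Finset.univ.filter (fun i : Fin n => (i : ℕ) < k), μ i
        = (n : ℝ)⁻¹ * ∑ i, μ i → ∀ i, μ i = μ ⟨k, hkn⟩) := by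
  set c := μ ⟨k, hkn⟩ with hc
  set P := ∑ i ∈ Finset.univ.filter (fun i : Fin n => (i : ℕ) < k), (c - μ i) with hP
  set Q := ∑ i ∈ Finset.univ.filter (fun i : Fin n => ¬ (i : ℕ) < k), (μ i - c) with hQ
  have hlow : ∀ i ∈ Finset.univ.filter (fun i : Fin n => (i : ℕ) < k), 0 ≤ c - μ i := by
    intro i hi
    exact sub_nonneg.2 (hμ (Fin.le_def.2 (Finset.mem_filter.1 hi).2.le))
  have hhigh : ∀ i ∈ Finset.univ.filter (fun i : Fin n => ¬ (i : ℕ) < k), 0 ≤ μ i - c := by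
    intro i hi
    exact sub_nonneg.2 (hμ (Fin.le_def.2 (not_lt.1 (Finset.mem_filter.1 hi).2)))
  have hcard : (Finset.univ.filter (fun i : Fin n => (i : ℕ) < k)).card = k := by
    rw [Fin.card_filter_val_lt, min_eq_right hkn.le]
  have h₁ : ∑ i ∈ Finset.univ.filter (fun i : Fin n => (i : ℕ) < k), μ i = k * c - P := by
    rw [hP, Finset.sum_sub_distrib, Finset.sum_const, hcard, nsmul_eq_mul]
    ring
  have h₂ : ∑ i, μ i = n * c - P + Q := by
    have h : ∑ i, (μ i - c) = -P + Q := by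
      rw [← Finset.sum_filter_add_sum_filter_not Finset.univ (fun i : Fin n => (i : ℕ) < k), hP,
        ← Finset.sum_neg_distrib]
      simp only [neg_sub, hQ]
    rw [Finset.sum_sub_distrib, Finset.sum_const, Finset.card_univ, Fintype.card_fin,
      nsmul_eq_mul] at h
    linarith
  have hP0 : 0 ≤ P := Finset.sum_nonneg hlow
  have hQ0 : 0 ≤ Q := Finset.sum_nonneg hhigh
  have hk0 : (0 : ℝ) < k := by exact_mod_cast hk
  have hkn' : (k : ℝ) < n := by exact_mod_cast hkn
  have hn0 : (0 : ℝ) < n := hk0.trans hkn'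
  have hdiff : (n : ℝ)⁻¹ * ∑ i, μ i -
      (k : ℝ)⁻¹ * ∑ i ∈ Finset.univ.filter (fun i : Fin n => (i : ℕ) < k), μ i =
      ((n - k) * P + k * Q) / (n * k) := by
    rw [h₁, h₂]
    field_simp
    ring
  have hnum : 0 ≤ (n - k) * P := mul_nonneg (sub_pos.2 hkn').le hP0
  have hnum' : 0 ≤ k * Q := mul_nonneg hk0.le hQ0
  refine ⟨?_, fun heq i => ?_⟩
  · rw [← sub_nonneg, hdiff]
    positivity
  · rw [heq, sub_self, eq_comm, div_eq_zero_iff, or_iff_left (by positivity)] at hdiff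
    by_cases hi : (i : ℕ) < k
    · have hPz : P = 0 := (mul_eq_zero.1 (by linarith)).resolve_left (sub_pos.2 hkn').ne'
      have := (Finset.sum_eq_zero_iff_of_nonneg hlow).1 hPz i (by simp [hi])
      linarith
    · have hQz : Q = 0 := (mul_eq_zero.1 (by linarith)).resolve_left hk0.ne'
      have := (Finset.sum_eq_zero_iff_of_nonneg hhigh).1 hQz i
        (Finset.mem_filter.2 ⟨Finset.mem_univ i, hi⟩)
      linarith

lemma exists_inner_eq (e : OrthonormalBasis (Fin n) ℝ V) (B : V →ₗ[ℝ] V →ₗ[ℝ] ℝ) :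
    ∃ T : V →ₗ[ℝ] V, ∀ x y, ⟪T x, y⟫ = B x y := by
  refine ⟨∑ j, (B.flip (e j)).smulRight (e j), fun x y => ?_⟩
  conv_rhs => rw [← e.sum_repr' y]
  simp only [LinearMap.sum_apply, LinearMap.smulRight_apply, LinearMap.flip_apply, sum_inner,
    real_inner_smul_left, map_sum, map_smul, smul_eq_mul]
  exact Finset.sum_congr rfl fun j _ => mul_comm _ _

lemma inner_ricOp (c : ℝ) (e : OrthonormalBasis (Fin n) ℝ V) (β : V →ₗ[ℝ] V →ₗ[ℝ] W)
    (x y : V) : ⟪ricOp c e β x, y⟫ = (n - 1 : ℝ)⁻¹ * ric c e β x y := by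
  have h : ∃ T : V →ₗ[ℝ] V, ∀ x y : V, ⟪T x, y⟫ = (n - 1 : ℝ)⁻¹ * ric c e β x y := by
    obtain ⟨T, hT⟩ := exists_inner_eq e (LinearMap.mk₂ ℝ
      (fun x y => (n - 1 : ℝ)⁻¹ * ric c e β x y)
      (fun _ _ _ => by
        simp only [ric, map_add, LinearMap.add_apply, inner_add_left, inner_add_right,
          Finset.sum_add_distrib]
        ring)
      (fun _ _ _ => by
        simp only [ric, map_smul, LinearMap.smul_apply, real_inner_smul_left,
          real_inner_smul_right, ← Finset.mul_sum, smul_eq_mul]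
        ring)
      (fun _ _ _ => by
        simp only [ric, map_add, LinearMap.add_apply, inner_add_right, Finset.sum_add_distrib]
        ring)
      (fun _ _ _ => by
        simp only [ric, map_smul, LinearMap.smul_apply, real_inner_smul_right, ← Finset.mul_sum,
          smul_eq_mul]
        ring))
    exact ⟨T, fun x y => by rw [hT, LinearMap.mk₂_apply]⟩
  rw [ricOp, dif_pos h]
  exact h.choose_spec x y

lemma ric_comm {β : V →ₗ[ℝ] V →ₗ[ℝ] W} (hβ : IsSymmBil β) (c : ℝ)
    (e : OrthonormalBasis (Fin n) ℝ V) (x y : V) : ric c e β x y = ric c e β y x := by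
  simp only [ric, hβ x y, real_inner_comm x y, real_inner_comm (β x _)]

lemma isSymmetric_ricOp {β : V →ₗ[ℝ] V →ₗ[ℝ] W} (hβ : IsSymmBil β) (c : ℝ)
    (e : OrthonormalBasis (Fin n) ℝ V) : (ricOp c e β).IsSymmetric := by
  intro x y
  rw [inner_ricOp, real_inner_comm, inner_ricOp, ric_comm hβ]

lemma sortedEigs_spec (e : OrthonormalBasis (Fin n) ℝ V) {T : V →ₗ[ℝ] V}
    (hT : T.IsSymmetric) : Monotone (sortedEigs n T) ∧
      ∃ b : OrthonormalBasis (Fin n) ℝ V, ∀ i, T (b i) = sortedEigs n T i • b i := by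
  have : FiniteDimensional ℝ V := e.toBasis.finiteDimensional_of_finite
  have hd : Module.finrank ℝ V = n := by
    rw [Module.finrank_eq_card_basis e.toBasis, Fintype.card_fin]
  have h : ∃ μ : Fin n → ℝ, Monotone μ ∧
      ∃ b : OrthonormalBasis (Fin n) ℝ V, ∀ i, T (b i) = μ i • b i :=
    ⟨fun i => hT.eigenvalues hd i.rev,
      fun i j hij => hT.eigenvalues_antitone hd (Fin.rev_anti hij),
      (hT.eigenvectorBasis hd).reindex Fin.revPerm, fun i => by
        simp [hT.apply_eigenvectorBasis]⟩
  rw [sortedEigs, dif_pos h]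
  exact h.choose_spec

lemma sum_sortedEigs (e : OrthonormalBasis (Fin n) ℝ V) {T : V →ₗ[ℝ] V}
    (hT : T.IsSymmetric) : ∑ i, sortedEigs n T i = ∑ i, ⟪T (e i), e i⟫ := by
  obtain ⟨-, b, hb⟩ := sortedEigs_spec e hT
  have h₁ := LinearMap.trace_eq_sum_inner T b
  have h₂ := LinearMap.trace_eq_sum_inner T e
  simp only [hb, real_inner_smul_right, real_inner_self_eq_norm_sq, b.norm_eq_one, one_pow,
    mul_one] at h₁
  rw [← h₁, h₂]
  exact Finset.sum_congr rfl fun i _ => real_inner_comm _ _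

/-- The matrices of the traceless part of `β` with respect to orthonormal bases. -/
noncomputable def tracelessMatrix (e : OrthonormalBasis (Fin n) ℝ V)
    (ξ : OrthonormalBasis (Fin m) ℝ W) (β : V →ₗ[ℝ] V →ₗ[ℝ] W) (a : Fin m) :
    Matrix (Fin n) (Fin n) ℝ :=
  Matrix.of fun i j => ⟪β (e i) (e j) - ⟪e i, e j⟫ • meanCurv e β, ξ a⟫

variable (e : OrthonormalBasis (Fin n) ℝ V) (ξ : OrthonormalBasis (Fin m) ℝ W)

lemma transpose_tracelessMatrix {β : V →ₗ[ℝ] V →ₗ[ℝ] W} (hβ : IsSymmBil β) (a : Fin m) :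
    (tracelessMatrix e ξ β a).transpose = tracelessMatrix e ξ β a := by
  ext i j
  simp only [tracelessMatrix, Matrix.transpose_apply, Matrix.of_apply, hβ (e j),
    real_inner_comm (e i)]

lemma commSq_tracelessMatrix (β : V →ₗ[ℝ] V →ₗ[ℝ] W) (a b : Fin m) :
    ∑ i, ‖(shapeOp β (ξ a) ∘ₗ shapeOp β (ξ b) - shapeOp β (ξ b) ∘ₗ shapeOp β (ξ a)) (e i)‖ ^ 2
      = commSq (tracelessMatrix e ξ β a) (tracelessMatrix e ξ β b) := by
  set N : Fin m → Matrix (Fin n) (Fin n) ℝ :=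
    fun a => Matrix.of fun i j => ⟪β (e i) (e j), ξ a⟫ with hN
  have hM : ∀ a, tracelessMatrix e ξ β a = N a - ⟪meanCurv e β, ξ a⟫ • 1 := by
    intro a
    ext i j
    simp only [tracelessMatrix, hN, inner_sub_left, real_inner_smul_left, e.inner_eq_ite,
      Matrix.one_apply, Matrix.of_apply, Matrix.sub_apply, Matrix.smul_apply, smul_eq_mul,
      mul_comm ⟪meanCurv e β, ξ a⟫]
  have hcomp : ∀ a b i j, ⟪shapeOp β (ξ a) (shapeOp β (ξ b) (e i)), e j⟫ = (N b * N a) i j := by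
    intro a b i j
    conv_lhs => rw [← e.sum_repr' (shapeOp β (ξ b) (e i))]
    simp only [map_sum, map_smul, sum_inner, real_inner_smul_left, Matrix.mul_apply]
    refine Finset.sum_congr rfl fun k _ => ?_
    rw [real_inner_comm, inner_shapeOp e, inner_shapeOp e]
    rfl
  rw [hM a, hM b, commSq_sub_smul_one, commSq_comm, commSq, frob_eq_sum]
  refine Finset.sum_congr rfl fun i _ => ?_
  rw [← e.sum_sq_inner_left]
  refine Finset.sum_congr rfl fun j _ => ?_
  simp only [LinearMap.sub_apply, LinearMap.comp_apply, inner_sub_left, hcomp, Matrix.sub_apply]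
  ring

lemma rhoPerp_eq (β : V →ₗ[ℝ] V →ₗ[ℝ] W) :
    rhoPerp e ξ β = (n * (n - 1) : ℝ)⁻¹ * √(∑ a, ∑ b,
      commSq (tracelessMatrix e ξ β a) (tracelessMatrix e ξ β b)) := by
  simp only [rhoPerp, commSq_tracelessMatrix]

lemma sum_apply_self (hn : n ≠ 0) (β : V →ₗ[ℝ] V →ₗ[ℝ] W) :
    ∑ i, β (e i) (e i) = (n : ℝ) • meanCurv e β := by
  rw [meanCurv, smul_smul, mul_inv_cancel₀ (by exact_mod_cast hn), one_smul]

lemma sum_frob_tracelessMatrix (hn : n ≠ 0) (β : V →ₗ[ℝ] V →ₗ[ℝ] W) :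
    ∑ a, frob (tracelessMatrix e ξ β a) (tracelessMatrix e ξ β a) =
      ∑ i, ∑ j, ‖β (e i) (e j)‖ ^ 2 - n * ‖meanCurv e β‖ ^ 2 := by
  have h₁ : ∀ i, ∑ j, ‖β (e i) (e j) - ⟪e i, e j⟫ • meanCurv e β‖ ^ 2 =
      ∑ j, ‖β (e i) (e j)‖ ^ 2 - 2 * ⟪β (e i) (e i), meanCurv e β⟫ + ‖meanCurv e β‖ ^ 2 := by
    intro i
    simp only [norm_sub_sq_real, Finset.sum_add_distrib, Finset.sum_sub_distrib, e.inner_eq_ite]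
    congr 1
    · congr 1
      rw [Finset.sum_eq_single i] <;> simp +contextual [eq_comm]
    · rw [Finset.sum_eq_single i] <;> simp +contextual [eq_comm]
  have h₂ : ∑ i, ⟪β (e i) (e i), meanCurv e β⟫ = n * ‖meanCurv e β‖ ^ 2 := by
    rw [← sum_inner, sum_apply_self e hn, real_inner_smul_left, real_inner_self_eq_norm_sq]
  simp only [frob_eq_sum, tracelessMatrix, Matrix.of_apply, ← sq]
  rw [Finset.sum_comm]
  simp only [Finset.sum_comm (s := (Finset.univ : Finset (Fin m))), ξ.sum_sq_inner_left, h₁,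
    Finset.sum_add_distrib, Finset.sum_sub_distrib, ← Finset.mul_sum, h₂, Finset.sum_const,
    Finset.card_univ, Fintype.card_fin, nsmul_eq_mul]
  ring

lemma mean_sortedEigs_ricOp (hn : 2 ≤ n) {β : V →ₗ[ℝ] V →ₗ[ℝ] W} (hβ : IsSymmBil β) (c : ℝ) :
    (n : ℝ)⁻¹ * ∑ i, sortedEigs n (ricOp c e β) i = c + ‖meanCurv e β‖ ^ 2 -
      (n * (n - 1) : ℝ)⁻¹ * ∑ a, frob (tracelessMatrix e ξ β a) (tracelessMatrix e ξ β a) := by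
  have hn' : (2 : ℝ) ≤ n := by exact_mod_cast hn
  have hn0 : (n : ℝ) ≠ 0 := by positivity
  have hn1 : (n : ℝ) - 1 ≠ 0 := by linarith
  have h : ∑ i, ric c e β (e i) (e i) = n * (c * (n - 1)) + n * (n * ‖meanCurv e β‖ ^ 2) -
      ∑ i, ∑ j, ‖β (e i) (e j)‖ ^ 2 := by
    have h₂ : ∑ i, ⟪meanCurv e β, β (e i) (e i)⟫ = n * ‖meanCurv e β‖ ^ 2 := by
      rw [← inner_sum, sum_apply_self e (by omega), real_inner_smul_right,
        real_inner_self_eq_norm_sq]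
    simp only [ric, Finset.sum_sub_distrib, Finset.sum_add_distrib, ← Finset.mul_sum, h₂,
      real_inner_self_eq_norm_sq, e.norm_eq_one]
    simp
    ring
  rw [sum_sortedEigs e (isSymmetric_ricOp hβ c e), sum_frob_tracelessMatrix e ξ (by omega)]
  simp only [inner_ricOp, ← Finset.mul_sum, h]
  field_simp
  ring

lemma ric_self_of_umbilic (c : ℝ) (β : V →ₗ[ℝ] V →ₗ[ℝ] W) {x : V}
    (hx : ∀ y, β x y = ⟪x, y⟫ • meanCurv e β) :
    ric c e β x x = (n - 1) * (c + ‖meanCurv e β‖ ^ 2) * ‖x‖ ^ 2 := by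
  simp only [ric, hx, real_inner_smul_right, real_inner_self_eq_norm_sq, norm_smul, mul_pow,
    Real.norm_eq_abs, sq_abs]
  have h : ∑ i, ⟪x, e i⟫ ^ 2 * ‖meanCurv e β‖ ^ 2 = ‖x‖ ^ 2 * ‖meanCurv e β‖ ^ 2 := by
    rw [← Finset.sum_mul, e.sum_sq_inner_left]
  rw [h]
  ring

lemma apply_eq_of_mulVec_eq_zero {β : V →ₗ[ℝ] V →ₗ[ℝ] W} (hβ : IsSymmBil β) {v : Fin n → ℝ}
    (hv : ∀ a, (tracelessMatrix e ξ β a).mulVec v = 0) (y : V) :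
    β (∑ i, v i • e i) y = ⟪∑ i, v i • e i, y⟫ • meanCurv e β := by
  set x := ∑ i, v i • e i with hx
  have h : ∀ i, β (e i) x = ⟪e i, x⟫ • meanCurv e β := by
    intro i
    rw [← sub_eq_zero]
    refine InnerProductSpace.ext_inner_right_basis (𝕜 := ℝ) ξ.toBasis fun a => ?_
    have ha := congrFun (hv a) i
    rw [Matrix.mulVec_eq_sum] at ha
    simp only [tracelessMatrix, Matrix.of_apply, Pi.zero_apply, Finset.sum_apply, Pi.smul_apply,
      Matrix.transpose_apply, op_smul_eq_smul, smul_eq_mul] at ha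
    rw [inner_zero_left, ← ha, hx, OrthonormalBasis.coe_toBasis]
    simp only [map_sum, map_smul, inner_sum, sum_inner, real_inner_smul_right, inner_sub_left,
      real_inner_smul_left, mul_sub, Finset.sum_sub_distrib, Finset.sum_mul]
    congr 1
    exact Finset.sum_congr rfl fun j _ => by ring
  rw [← e.sum_repr' y]
  rw [map_sum, inner_sum, Finset.sum_smul]
  refine Finset.sum_congr rfl fun i _ => ?_
  rw [map_smul, hβ x, h, real_inner_smul_right, real_inner_comm x (e i), smul_smul]

end Geometry

/-- `ρ_{c,k}(β) ≤ c + H_β² − ρ⊥(β)` for `1 ≤ k ≤ n−1`, with equality for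
some such `k` iff `β` is umbilical. -/
theorem stmt5 (n m : ℕ) (hn : 3 ≤ n) (hm : 1 ≤ m)
    {V W : Type*} [NormedAddCommGroup V] [InnerProductSpace ℝ V]
    [NormedAddCommGroup W] [InnerProductSpace ℝ W]
    (e : OrthonormalBasis (Fin n) ℝ V) (ξ : OrthonormalBasis (Fin m) ℝ W)
    (β : V →ₗ[ℝ] V →ₗ[ℝ] W) (hβ : IsSymmBil β) (c : ℝ) :
    (∀ k : ℕ, 1 ≤ k → k ≤ n - 1 →
      rhoK c k e β ≤ c + ‖meanCurv e β‖ ^ 2 - rhoPerp e ξ β) ∧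
    ((∃ k : ℕ, 1 ≤ k ∧ k ≤ n - 1 ∧
        rhoK c k e β = c + ‖meanCurv e β‖ ^ 2 - rhoPerp e ξ β) ↔
      ∀ x y : V, β x y = ⟪x, y⟫ • meanCurv e β) := by
  have hn' : (3 : ℝ) ≤ n := by exact_mod_cast hn
  have hn0 : (0 : ℝ) < n := by linarith
  have hn1 : (0 : ℝ) < n - 1 := by linarith
  have hC : (0 : ℝ) < (n * (n - 1) : ℝ)⁻¹ := by positivity
  set τ := ∑ a, frob (tracelessMatrix e ξ β a) (tracelessMatrix e ξ β a) with hτ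
  have hτ0 : 0 ≤ τ := Finset.sum_nonneg fun a _ => frob_self_nonneg _
  have hddvv := sum_sum_commSq_le (fun a => transpose_tracelessMatrix e ξ hβ a)
  rw [← hτ] at hddvv
  have hmean := mean_sortedEigs_ricOp e ξ (by omega) hβ c
  rw [← hτ] at hmean
  obtain ⟨hmono, b, hb⟩ := sortedEigs_spec e (isSymmetric_ricOp hβ c e)
  have hperp : rhoPerp e ξ β ≤ (n * (n - 1) : ℝ)⁻¹ * τ := by
    rw [rhoPerp_eq]
    exact mul_le_mul_of_nonneg_left (Real.sqrt_le_iff.2 ⟨hτ0, hddvv⟩) hC.le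
  have hle : ∀ k : ℕ, 1 ≤ k → k ≤ n - 1 →
      rhoK c k e β ≤ c + ‖meanCurv e β‖ ^ 2 - (n * (n - 1) : ℝ)⁻¹ * τ := by
    intro k hk hkn
    rw [← hmean]
    exact (mean_prefix_le _ hmono hk (by omega)).1
  refine ⟨fun k hk hkn => by linarith [hle k hk hkn], ?_, ?_⟩
  · rintro ⟨k, hk, hkn, heq⟩
    have hkn' : k < n := by omega
    have hk_eq : rhoK c k e β = c + ‖meanCurv e β‖ ^ 2 - (n * (n - 1) : ℝ)⁻¹ * τ :=
      le_antisymm (hle k hk hkn) (by linarith)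
    have hconst := (mean_prefix_le _ hmono hk hkn').2 (hk_eq.trans hmean.symm)
    set lam := sortedEigs n (ricOp c e β) ⟨k, hkn'⟩ with hlam
    have hlam_eq : lam = c + ‖meanCurv e β‖ ^ 2 - (n * (n - 1) : ℝ)⁻¹ * τ := by
      rw [← hmean]
      simp only [hconst, Finset.sum_const, Finset.card_univ, Fintype.card_fin, nsmul_eq_mul]
      field_simp
    have hT : ricOp c e β = lam • LinearMap.id := by
      refine b.toBasis.ext fun i => ?_
      rw [OrthonormalBasis.coe_toBasis, hb, hconst]
      rfl
    have hcomm : ∑ a, ∑ b, commSq (tracelessMatrix e ξ β a) (tracelessMatrix e ξ β b) =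
        τ ^ 2 := by
      have h : (n * (n - 1) : ℝ)⁻¹ * √(∑ a, ∑ b,
          commSq (tracelessMatrix e ξ β a) (tracelessMatrix e ξ β b)) =
          (n * (n - 1) : ℝ)⁻¹ * τ := by
        rw [← rhoPerp_eq]
        linarith
      rw [← mul_left_cancel₀ hC.ne' h, Real.sq_sqrt]
      exact Finset.sum_nonneg fun a _ => Finset.sum_nonneg fun b _ => commSq_nonneg _ _
    obtain ⟨v, hv, hker⟩ := exists_mulVec_eq_zero_of_eq (by simpa using hn)
      (fun a => transpose_tracelessMatrix e ξ hβ a) hcomm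
    have hx := apply_eq_of_mulVec_eq_zero e ξ hβ hker
    set x := ∑ i, v i • e i with hx_def
    have hx0 : x ≠ 0 := fun h0 => hv <| funext fun i =>
      Fintype.linearIndependent_iff.1 e.orthonormal.linearIndependent v (hx_def.symm.trans h0) i
    have hric := inner_ricOp c e β x x
    rw [ric_self_of_umbilic e c β hx, hT, LinearMap.smul_apply, LinearMap.id_apply,
      real_inner_smul_left, real_inner_self_eq_norm_sq, mul_assoc, inv_mul_cancel_left₀ hn1.ne']
      at hric
    have hlam_eq' := mul_right_cancel₀ (pow_ne_zero 2 (norm_ne_zero_iff.2 hx0)) hric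
    have hτz : τ = 0 := (mul_eq_zero.1 (by linarith : (n * (n - 1) : ℝ)⁻¹ * τ = 0)).resolve_left
      hC.ne'
    have hM : ∀ a, tracelessMatrix e ξ β a = 0 := fun a => eq_zero_of_frob_self_eq_zero <|
      (Finset.sum_eq_zero_iff_of_nonneg fun a _ => frob_self_nonneg _).1 hτz a (Finset.mem_univ a)
    intro y z
    have h := apply_eq_of_mulVec_eq_zero e ξ hβ (v := fun i => ⟪e i, y⟫)
      (fun a => by rw [hM a, Matrix.zero_mulVec]) z
    rwa [e.sum_repr' y] at h
  · intro humb
    have hM : ∀ a, tracelessMatrix e ξ β a = 0 := by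
      intro a
      ext i j
      simp [tracelessMatrix, humb (e i)]
    refine ⟨1, le_rfl, by omega, ?_⟩
    have hperp0 : rhoPerp e ξ β = 0 := by
      simp [rhoPerp_eq, hM, commSq_self]
    have hμ : ∀ i, sortedEigs n (ricOp c e β) i = c + ‖meanCurv e β‖ ^ 2 := by
      intro i
      have h := inner_ricOp c e β (b i) (b i)
      rwa [hb, ric_self_of_umbilic e c β (humb _), real_inner_smul_left,
        real_inner_self_eq_norm_sq, b.norm_eq_one, one_pow, mul_one, mul_one,
        inv_mul_cancel_left₀ hn1.ne'] at h
    have hcard : (Finset.univ.filter (fun i : Fin n => (i : ℕ) < 1)).card = 1 := by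
      rw [Fin.card_filter_val_lt, min_eq_right (by omega)]
    rw [rhoK, hperp0, Finset.sum_congr rfl fun i _ => hμ i, Finset.sum_const, hcard]
    simp

end Paper
end
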